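/- arXiv:1010.3424 — 2 statements merged into one kernel-verified Lean document; each statement's English description precedes it below -/
import Mathlib

section
/- Let Γ be a finitely generated nonamenable sofic group. Then there exist two faithful embeddings φ, ψ of Γ into the metric ultraproduct Σ of finite symmetric groups that are not conjugate, i.e., there is no g ∈ Σ with φ(γ) = g ψ(γ) g⁻¹ for all γ ∈ Γ. -/
open Filter Topology

/-- A finite colored (edge-labeled) directed graph with labels in `L`. -/
structure CGraph (L : Type) where
  n : ℕ
  edges : Finset (Fin n × Fin n × L)

namespace CGraph

variable {L : Type} [DecidableEq L]

/-- Map an edge along a vertex map. -/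
def mapEdge {n m : ℕ} (f : Fin n → Fin m) (e : Fin n × Fin n × L) : Fin m × Fin m × L :=
  (f e.1, f e.2.1, e.2.2)

/-- The vertices appearing in an edge set. -/
def supp {n : ℕ} (E : Finset (Fin n × Fin n × L)) : Finset (Fin n) :=
  E.image (·.1) ∪ E.image (·.2.1)

/-- `f`, `EA` witness an `r`-isomorphism between `A` and `B`: `EA` is a subgraph of `A`
containing at least a `(1 - 1/r)`-fraction of the edges of `A`, whose image under the
(injective-on-`EA`) vertex map `f` is a subgraph of `B` containing at least a
`(1 - 1/r)`-fraction of the edges of `B`. -/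
def IsRIsoWitness (r : ℕ) (A B : CGraph L) (f : Fin A.n → Fin B.n)
    (EA : Finset (Fin A.n × Fin A.n × L)) : Prop :=
  EA ⊆ A.edges ∧ Set.InjOn f (supp EA) ∧
    EA.image (mapEdge f) ⊆ B.edges ∧
    ((1 : ℝ) - 1 / r) * A.edges.card ≤ EA.card ∧
    ((1 : ℝ) - 1 / r) * B.edges.card ≤ EA.card

/-- `A` and `B` are `r`-isomorphic colored graphs. -/
def RIso (r : ℕ) (A B : CGraph L) : Prop :=
  ∃ f EA, IsRIsoWitness r A B f EA

/-- Disjoint union of colored graphs. -/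
def disjUnion (A B : CGraph L) : CGraph L :=
  ⟨A.n + B.n,
    (A.edges.image (mapEdge (Fin.castAdd B.n))) ∪ (B.edges.image (mapEdge (Fin.natAdd A.n)))⟩

/-- Disjoint union of `k` copies of `A`. -/
def nsmul : ℕ → CGraph L → CGraph L
  | 0, _ => ⟨0, ∅⟩
  | k + 1, A => disjUnion A (nsmul k A)

/-- The linear combination `α · T`: disjoint union of `α i` copies of `T i`. -/
def lincomb {m : ℕ} (α : Fin m → ℕ) (T : Fin m → CGraph L) : CGraph L :=
  (List.finRange m).foldr (fun i B => disjUnion (nsmul (α i) (T i)) B) ⟨0, ∅⟩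

/-- Restriction of a colored graph to the edges whose color lies in `Z`. -/
def restrict (A : CGraph L) (Z : Finset L) : CGraph L :=
  ⟨A.n, A.edges.filter (fun e => e.2.2 ∈ Z)⟩

variable {Γ : Type*} [Group Γ]

/-- The ball of radius `r` around `1` in the Cayley graph of `Γ` with respect to the
generators `lab '' S`. -/
def ball (lab : L → Γ) (S : Finset L) (r : ℕ) : Set Γ :=
  {γ | ∃ w : List L, (∀ x ∈ w, x ∈ S) ∧ w.length ≤ r ∧ (w.map lab).prod = γ}

/-- The vertex `p` of `G` has an `r`-neighborhood isomorphic, as a rooted edge-labeled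
graph, to the `r`-ball of the Cayley graph of `Γ` with generators `lab '' S`. -/
def GoodVertex (lab : L → Γ) (S : Finset L) (G : CGraph L) (r : ℕ) (p : Fin G.n) : Prop :=
  ∃ f : Γ → Fin G.n, f 1 = p ∧ Set.InjOn f (ball lab S r) ∧
    ∀ γ ∈ ball lab S r, ∀ δ ∈ ball lab S r, ∀ c : L,
      ((f γ, f δ, c) ∈ G.edges ↔ (c ∈ S ∧ δ = γ * lab c))

/-- `G` is an `r`-approximation of the Cayley graph of `Γ` with generators `lab '' S`. -/
def IsApprox (lab : L → Γ) (S : Finset L) (G : CGraph L) (r : ℕ) : Prop :=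
  ((1 : ℝ) - 1 / r) * G.n < {p : Fin G.n | GoodVertex lab S G r p}.ncard

/-- A sofic approximation: for each `r`, eventually all graphs are `r`-approximations. -/
def SoficApprox (lab : L → Γ) (S : Finset L) (G : ℕ → CGraph L) : Prop :=
  ∀ r : ℕ, ∀ᶠ n in atTop, IsApprox lab S (G n) r

/-- Two vertices are adjacent with respect to an edge set (ignoring colors/orientation). -/
def adjRel {n : ℕ} (E : Finset (Fin n × Fin n × L)) (a b : Fin n) : Prop :=
  ∃ c, (a, b, c) ∈ E ∨ (b, a, c) ∈ E

/-- The connected component of `v` with respect to an edge set. -/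
def component {n : ℕ} (E : Finset (Fin n × Fin n × L)) (v : Fin n) : Set (Fin n) :=
  {w | Relation.ReflTransGen (adjRel E) v w}

/-- A sequence of finite colored graphs is hyperfinite if for every `ε > 0` there is `K`
such that from each `G n` one can erase at most `ε |E(G n)|` edges so that all components
of the remaining graph have at most `K` vertices. -/
def Hyperfinite (G : ℕ → CGraph L) : Prop :=
  ∀ ε : ℝ, 0 < ε → ∃ K : ℕ, ∀ n, ∃ F ⊆ (G n).edges,
    (F.card : ℝ) ≤ ε * (G n).edges.card ∧
    ∀ v, (component ((G n).edges \ F) v).ncard ≤ K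

end CGraph

/-- The normalized Hamming rank of a permutation of `Fin n`. -/
noncomputable def rk {n : ℕ} (g : Equiv.Perm (Fin n)) : ℝ :=
  1 - (Finset.univ.filter fun x => g x = x).card / n

/-- `F` is a Følner sequence of finite subsets of `Γ` with respect to the generating set `S`. -/
def IsFolnerSeq {Γ : Type*} [Group Γ] [DecidableEq Γ] (S : Finset Γ) (F : ℕ → Finset Γ) : Prop :=
  (∀ n, (F n).Nonempty) ∧ ∀ s ∈ S,
    Tendsto (fun n => (((F n).image (· * s) \ F n).card : ℝ) / (F n).card) atTop (𝓝 0)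

/-- A sofic representation of `Γ`: a map to the product of finite symmetric groups which is a
homomorphism into the metric ultraproduct `Σ = (∏ Sₙ)/H` and is faithful there
(`rk (φ γ) = 1` for `γ ≠ 1`). -/
def IsSoficRep (ω : Ultrafilter ℕ) {Γ : Type*} [Group Γ] (N : ℕ → ℕ)
    (φ : Γ → ∀ n : ℕ, Equiv.Perm (Fin (N n))) : Prop :=
  (∀ γ δ : Γ, Tendsto (fun n => rk ((φ γ n * φ δ n)⁻¹ * φ (γ * δ) n)) ω (𝓝 0)) ∧
  (∀ γ : Γ, γ ≠ 1 → Tendsto (fun n => rk (φ γ n)) ω (𝓝 1))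

/-- Two sofic representations are conjugate by an element `g` of the metric ultraproduct. -/
def ConjugateReps (ω : Ultrafilter ℕ) {Γ : Type*} [Group Γ] (N : ℕ → ℕ)
    (φ ψ : Γ → ∀ n : ℕ, Equiv.Perm (Fin (N n))) : Prop :=
  ∃ g : ∀ n : ℕ, Equiv.Perm (Fin (N n)), ∀ γ,
    Tendsto (fun n => rk ((g n * ψ γ n * (g n)⁻¹)⁻¹ * φ γ n)) ω (𝓝 0)

/-- A group is sofic: every finite subset admits arbitrarily good almost-multiplicative,
almost-free approximations by permutations. -/
def IsSofic (G : Type*) [Group G] : Prop :=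
  ∀ (F : Finset G) (ε : ℝ), 0 < ε → ∃ (n : ℕ) (f : G → Equiv.Perm (Fin n)), 0 < n ∧
    (∀ g ∈ F, ∀ h ∈ F, rk ((f g * f h)⁻¹ * f (g * h)) ≤ ε) ∧
    (∀ g ∈ F, g ≠ 1 → 1 - ε ≤ rk (f g))

open Classical in
/-- A group is amenable: it satisfies the Følner condition. -/
def IsAmenable (G : Type*) [Group G] : Prop :=
  ∀ (F : Finset G) (ε : ℝ), 0 < ε → ∃ A : Finset G, A.Nonempty ∧
    ∀ g ∈ F, (((A.image (g * ·)) \ A).card : ℝ) ≤ ε * A.card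

namespace SoficConjugacy

open Finset Pointwise

open Classical in
/-- The points at which `σ` fails to act on `T` like a free action of `Γ`. -/
noncomputable def bad {Γ V : Type*} [Group Γ] [Fintype V] (σ : Γ → Equiv.Perm V)
    (T : Finset Γ) : Finset V :=
  univ.filter fun x => ¬ ((∀ γ ∈ T, ∀ δ ∈ T, σ γ (σ δ x) = σ (γ * δ) x) ∧
    ∀ γ ∈ T, γ ≠ 1 → σ γ x ≠ x)

section Bad

variable {Γ V : Type*} [Group Γ] [Fintype V] {σ : Γ → Equiv.Perm V} {T T' : Finset Γ} {x : V}

lemma notMem_bad : x ∉ bad σ T ↔ (∀ γ ∈ T, ∀ δ ∈ T, σ γ (σ δ x) = σ (γ * δ) x) ∧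
    ∀ γ ∈ T, γ ≠ 1 → σ γ x ≠ x := by
  simp only [bad, mem_filter, mem_univ, true_and, not_not]

lemma bad_mono (h : T ⊆ T') : bad σ T ⊆ bad σ T' := by
  intro x hx
  by_contra hx'
  rw [notMem_bad] at hx'
  exact notMem_bad.2 ⟨fun γ hγ δ hδ => hx'.1 γ (h hγ) δ (h hδ), fun γ hγ => hx'.2 γ (h hγ)⟩ hx

lemma map_one_of_notMem_bad (h1 : (1 : Γ) ∈ T) (hx : x ∉ bad σ T) : σ 1 x = x := by
  have := (notMem_bad.1 hx).1 1 h1 1 h1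
  rw [mul_one] at this
  exact (σ 1).injective this

end Bad

section Rank

lemma rk_eq_card_ne {n : ℕ} (hn : 0 < n) (g : Equiv.Perm (Fin n)) :
    rk g * n = (univ.filter fun x => g x ≠ x).card := by
  have h := card_filter_add_card_filter_not (s := (univ : Finset (Fin n))) (fun x => g x = x)
  rw [card_univ, Fintype.card_fin] at h
  have hn' : (n : ℝ) ≠ 0 := by positivity
  have h' : ((univ.filter fun x => g x = x).card : ℝ) + (univ.filter fun x => g x ≠ x).card = n := by
    exact_mod_cast h
  rw [rk, sub_mul, div_mul_cancel₀ _ hn']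
  linarith

lemma one_sub_rk_eq_card {n : ℕ} (hn : 0 < n) (g : Equiv.Perm (Fin n)) :
    (1 - rk g) * n = (univ.filter fun x => g x = x).card := by
  have hn' : (n : ℝ) ≠ 0 := by positivity
  rw [rk, sub_sub_cancel, div_mul_cancel₀ _ hn']

lemma rk_inv_mul_eq_card {n : ℕ} (hn : 0 < n) (g h : Equiv.Perm (Fin n)) :
    rk (g⁻¹ * h) * n = (univ.filter fun x => g x ≠ h x).card := by
  rw [rk_eq_card_ne hn]
  congr 2
  ext x
  simp only [mem_filter, mem_univ, true_and, Equiv.Perm.mul_apply, ne_eq,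
    Equiv.Perm.inv_eq_iff_eq]
  exact not_congr eq_comm

lemma rk_nonneg {n : ℕ} (g : Equiv.Perm (Fin n)) : 0 ≤ rk g := by
  have h : (univ.filter fun x => g x = x).card ≤ n := by
    simpa using card_filter_le (univ : Finset (Fin n)) (fun x => g x = x)
  rw [rk, sub_nonneg]
  exact div_le_one_of_le₀ (by exact_mod_cast h) (by positivity)

lemma rk_le_one {n : ℕ} (g : Equiv.Perm (Fin n)) : rk g ≤ 1 := by
  rw [rk, sub_le_self_iff]
  positivity

variable {Γ : Type*} [Group Γ]

lemma card_bad_le {n : ℕ} (hn : 0 < n) (σ : Γ → Equiv.Perm (Fin n)) (T : Finset Γ) [DecidableEq Γ] :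
    ((bad σ T).card : ℝ) ≤ (∑ q ∈ T ×ˢ T, rk ((σ q.1 * σ q.2)⁻¹ * σ (q.1 * q.2)) +
      ∑ γ ∈ T.erase 1, (1 - rk (σ γ))) * n := by
  have hsub : bad σ T ⊆
      ((T ×ˢ T).biUnion fun q => univ.filter fun x => (σ q.1 * σ q.2) x ≠ σ (q.1 * q.2) x) ∪
      ((T.erase 1).biUnion fun γ => univ.filter fun x => σ γ x = x) := by
    intro x hx
    by_contra hx'
    refine notMem_bad.2 ⟨fun γ hγ δ hδ => by_contra fun h => hx' (mem_union_left _ ?_),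
      fun γ hγ h1 h => hx' (mem_union_right _ ?_)⟩ hx
    · exact mem_biUnion.2 ⟨(γ, δ), mem_product.2 ⟨hγ, hδ⟩, mem_filter.2 ⟨mem_univ _, h⟩⟩
    · exact mem_biUnion.2 ⟨γ, mem_erase.2 ⟨h1, hγ⟩, mem_filter.2 ⟨mem_univ _, h⟩⟩
  have h := (card_le_card hsub).trans (card_union_le _ _)
  have h' := h.trans (add_le_add card_biUnion_le card_biUnion_le)
  rw [add_mul, sum_mul, sum_mul]
  simp_rw [rk_inv_mul_eq_card hn, one_sub_rk_eq_card hn]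
  exact_mod_cast h'

lemma eventually_pos {ω : Ultrafilter ℕ} (hω : (ω : Filter ℕ) ≤ cofinite) :
    ∀ᶠ n in (ω : Filter ℕ), 0 < n :=
  hω (by rw [Nat.cofinite_eq_atTop]; exact eventually_gt_atTop 0)

/-- A family of maps into symmetric groups is a sofic representation iff, for every finite
`T ⊆ Γ`, the proportion of bad points tends to zero. -/
lemma isSoficRep_iff {ω : Ultrafilter ℕ} (hω : (ω : Filter ℕ) ≤ cofinite)
    (φ : Γ → ∀ n : ℕ, Equiv.Perm (Fin n)) :
    IsSoficRep ω (fun n => n) φ ↔ ∀ (T : Finset Γ) (ε : ℝ), 0 < ε →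
      ∀ᶠ n in (ω : Filter ℕ), ((bad (fun γ => φ γ n) T).card : ℝ) ≤ ε * n := by
  classical
  constructor
  · rintro ⟨hmul, hfree⟩ T ε hε
    have h1 : Tendsto (fun n => ∑ q ∈ T ×ˢ T,
        rk ((φ q.1 n * φ q.2 n)⁻¹ * φ (q.1 * q.2) n) +
        ∑ γ ∈ T.erase 1, (1 - rk (φ γ n))) ω (𝓝 0) := by
      have ha := tendsto_finsetSum (T ×ˢ T) fun q _ => hmul q.1 q.2
      have hb := tendsto_finsetSum (T.erase 1) fun γ hγ =>
        (hfree γ (mem_erase.1 hγ).1).const_sub 1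
      simpa using ha.add hb
    filter_upwards [h1.eventually_lt_const hε, eventually_pos hω] with n hlt hn
    exact (card_bad_le hn _ T).trans (by gcongr)
  · intro h
    constructor
    · intro γ δ
      rw [Metric.tendsto_nhds]
      intro ε hε
      filter_upwards [h {γ, δ} (ε / 2) (by positivity), eventually_pos hω] with n hbad hn
      have hn' : (0 : ℝ) < n := by exact_mod_cast hn
      rw [Real.dist_0_eq_abs, abs_of_nonneg (rk_nonneg _)]
      have hle : rk ((φ γ n * φ δ n)⁻¹ * φ (γ * δ) n) * n ≤ ε / 2 * n := by
        rw [rk_inv_mul_eq_card hn]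
        refine le_trans ?_ hbad
        exact_mod_cast card_le_card fun x hx => by
          by_contra hx'
          exact (mem_filter.1 hx).2 ((notMem_bad.1 hx').1 γ (by simp) δ (by simp))
      have := le_of_mul_le_mul_right hle hn'
      linarith
    · intro γ hγ
      rw [Metric.tendsto_nhds]
      intro ε hε
      filter_upwards [h {γ} (ε / 2) (by positivity), eventually_pos hω] with n hbad hn
      have hn' : (0 : ℝ) < n := by exact_mod_cast hn
      rw [dist_comm, Real.dist_eq, abs_of_nonneg (sub_nonneg.2 (rk_le_one _))]
      have hle : (1 - rk (φ γ n)) * n ≤ ε / 2 * n := by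
        rw [one_sub_rk_eq_card hn]
        refine le_trans ?_ hbad
        exact_mod_cast card_le_card fun x hx => by
          by_contra hx'
          exact (notMem_bad.1 hx').2 γ (by simp) hγ (mem_filter.1 hx).2
      have := le_of_mul_le_mul_right hle hn'
      linarith

end Rank

section Balls

variable {Γ : Type*} [Group Γ] [DecidableEq Γ] {S : Finset Γ}

lemma pow_insert_mono {m k : ℕ} (h : m ≤ k) : (insert 1 S) ^ m ⊆ (insert 1 S) ^ k :=
  pow_subset_pow_right (mem_insert_self _ _) h

lemma one_mem_pow_insert (k : ℕ) : (1 : Γ) ∈ (insert 1 S) ^ k :=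
  one_mem_pow (mem_insert_self _ _)

lemma inv_mem_pow_insert (hsym : ∀ s ∈ S, s⁻¹ ∈ S) {k : ℕ} {γ : Γ}
    (h : γ ∈ (insert 1 S) ^ k) : γ⁻¹ ∈ (insert 1 S) ^ k := by
  have hsub : (insert 1 S)⁻¹ ⊆ insert 1 S := by
    intro x hx
    rw [mem_inv'] at hx
    rcases mem_insert.1 hx with h | h
    · simp [inv_eq_one.1 h]
    · exact mem_insert_of_mem (by simpa using hsym _ h)
  have : γ⁻¹ ∈ ((insert 1 S) ^ k)⁻¹ := inv_mem_inv h
  rw [← inv_pow] at this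
  exact pow_subset_pow_left hsub this

lemma exists_mem_pow_insert (hsym : ∀ s ∈ S, s⁻¹ ∈ S)
    (hgen : Subgroup.closure (S : Set Γ) = ⊤) (γ : Γ) : ∃ k, γ ∈ (insert 1 S) ^ k := by
  have hγ : γ ∈ Subgroup.closure (S : Set Γ) := hgen ▸ Subgroup.mem_top γ
  induction hγ using Subgroup.closure_induction with
  | mem x hx => exact ⟨1, by rw [pow_one]; exact mem_insert_of_mem hx⟩
  | one => exact ⟨0, one_mem_pow_insert 0⟩
  | mul x y _ _ hx hy =>
    obtain ⟨a, ha⟩ := hx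
    obtain ⟨b, hb⟩ := hy
    exact ⟨a + b, by rw [pow_add]; exact mul_mem_mul ha hb⟩
  | inv x _ hx =>
    obtain ⟨a, ha⟩ := hx
    exact ⟨a, inv_mem_pow_insert hsym ha⟩

lemma exists_subset_pow_insert (hsym : ∀ s ∈ S, s⁻¹ ∈ S)
    (hgen : Subgroup.closure (S : Set Γ) = ⊤) (T : Finset Γ) : ∃ k, T ⊆ (insert 1 S) ^ k := by
  choose k hk using exists_mem_pow_insert hsym hgen
  exact ⟨T.sup k, fun γ hγ => pow_insert_mono (le_sup hγ) (hk γ)⟩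

end Balls

section Isoperimetry

variable {Γ : Type*} [Group Γ] [DecidableEq Γ] {S : Finset Γ}

/-- A group without Følner sequences satisfies a linear isoperimetric inequality. -/
lemma exists_isoperimetric_constant (hsym : ∀ s ∈ S, s⁻¹ ∈ S)
    (hnonamen : ¬ ∃ F : ℕ → Finset Γ, IsFolnerSeq S F) :
    ∃ c : ℝ, 0 < c ∧ ∀ F : Finset Γ,
      c * F.card ≤ ∑ s ∈ S, ((F.filter fun γ => s * γ ∉ F).card : ℝ) := by
  by_contra! hcon
  choose F hF using fun j : ℕ => hcon (1 / ((j : ℝ) + 1)) (by positivity)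
  have hne : ∀ j, (F j).Nonempty := by
    intro j
    by_contra h
    have := hF j
    rw [not_nonempty_iff_eq_empty.1 h] at this
    simp at this
  refine hnonamen ⟨fun j => (F j)⁻¹, fun j => (hne j).inv, fun s hs => ?_⟩
  refine squeeze_zero (fun j => by positivity) (fun j => ?_) tendsto_one_div_add_atTop_nhds_zero_nat
  have hpos : (0 : ℝ) < (F j).card := by exact_mod_cast (hne j).card_pos
  rw [card_inv, div_le_iff₀ hpos]
  refine le_trans ?_ (hF j).le
  refine le_trans ?_ (single_le_sum (f := fun s => (((F j).filter fun γ => s * γ ∉ F j).card : ℝ))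
    (fun _ _ => by positivity) (hsym s hs))
  have hsub : (F j)⁻¹.image (· * s) \ (F j)⁻¹ ⊆
      ((F j).filter fun γ => s⁻¹ * γ ∉ F j).image fun γ => γ⁻¹ * s := by
    intro x hx
    simp only [Finset.mem_sdiff, Finset.mem_image, Finset.mem_inv', Finset.mem_filter] at hx ⊢
    obtain ⟨⟨y, hy, rfl⟩, hx⟩ := hx
    exact ⟨y⁻¹, ⟨hy, by simpa using hx⟩, by simp⟩
  exact_mod_cast (card_le_card hsub).trans card_image_le

variable {V : Type*} [Fintype V] {σ : Γ → Equiv.Perm V}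

lemma injOn_orbit_map (hsym : ∀ s ∈ S, s⁻¹ ∈ S) {m : ℕ} {x : V}
    (hx : x ∉ bad σ ((insert 1 S) ^ (2 * m))) :
    Set.InjOn (fun γ => σ γ x) ((insert 1 S) ^ m : Finset Γ) := by
  intro γ hγ δ hδ h
  have hm : m ≤ 2 * m := by omega
  have hδ' := inv_mem_pow_insert hsym (mem_coe.1 hδ)
  have h1 := (notMem_bad.1 hx).1 δ⁻¹ (pow_insert_mono hm hδ') γ (pow_insert_mono hm hγ)
  have h2 := (notMem_bad.1 hx).1 δ⁻¹ (pow_insert_mono hm hδ') δ (pow_insert_mono hm hδ)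
  simp only at h
  rw [inv_mul_cancel, map_one_of_notMem_bad (one_mem_pow_insert _) hx] at h2
  rw [h, h2] at h1
  by_contra hne
  refine (notMem_bad.1 hx).2 (δ⁻¹ * γ) ?_ ?_ h1.symm
  · rw [two_mul, pow_add]
    exact mul_mem_mul hδ' hγ
  · rw [Ne, inv_mul_eq_one]
    exact fun h => hne h.symm

variable [DecidableEq V]

/-- The lift to `Γ` of the connected component of `x` in `C`. -/
lemma exists_component_lift (hsym : ∀ s ∈ S, s⁻¹ ∈ S) {K : ℕ} {C : Finset V} {x : V}
    (hxC : x ∈ C) (hC : C.card ≤ K) (hx : x ∉ bad σ ((insert 1 S) ^ (2 * (K + 1)))) :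
    ∃ F ⊆ (insert 1 S) ^ K, 1 ∈ F ∧ (∀ γ ∈ F, σ γ x ∈ C) ∧
      ∀ γ ∈ F, ∀ s ∈ S, σ (s * γ) x ∈ C → s * γ ∈ F := by
  let step : Finset Γ → Finset Γ := fun F => F ∪ (S * F).filter fun γ => σ γ x ∈ C
  let F : ℕ → Finset Γ := fun r => step^[r] {1}
  have hsucc : ∀ r, F (r + 1) = F r ∪ (S * F r).filter fun γ => σ γ x ∈ C := fun r =>
    Function.iterate_succ_apply' step r {1}
  have hone : ∀ r, 1 ∈ F r := by
    intro r
    induction r with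
    | zero => simp [F]
    | succ r ih => rw [hsucc]; exact mem_union_left _ ih
  have hball : ∀ r, F r ⊆ (insert 1 S) ^ r := by
    intro r
    induction r with
    | zero => simp [F]
    | succ r ih =>
      rw [hsucc]
      refine union_subset (ih.trans (pow_insert_mono r.le_succ)) ((filter_subset _ _).trans ?_)
      rw [pow_succ']
      exact mul_subset_mul (subset_insert _ _) ih
  have hmem : ∀ r, ∀ γ ∈ F r, σ γ x ∈ C := by
    intro r
    induction r with
    | zero =>
      intro γ hγ
      rw [mem_singleton.1 hγ, map_one_of_notMem_bad (one_mem_pow_insert _) hx]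
      exact hxC
    | succ r ih =>
      intro γ hγ
      rw [hsucc] at hγ
      rcases mem_union.1 hγ with h | h
      · exact ih γ h
      · exact (mem_filter.1 h).2
  have hstab : ∃ r ≤ K, F (r + 1) = F r := by
    by_contra! hne
    have hcard : ∀ r ≤ K + 1, r ≤ (F r).card := by
      intro r
      induction r with
      | zero => simp
      | succ r ih =>
        intro hr
        have hss : F r ⊂ F (r + 1) :=
          Finset.ssubset_iff_subset_ne.2 ⟨by rw [hsucc]; exact subset_union_left,
            (hne r (by omega)).symm⟩
        have := card_lt_card hss
        have := ih (by omega)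
        omega
    have h1 := hcard (K + 1) le_rfl
    have h2 : (F (K + 1)).card ≤ C.card :=
      card_le_card_of_injOn (fun γ => σ γ x) (hmem _)
        ((injOn_orbit_map hsym hx).mono (by exact_mod_cast hball (K + 1)))
    omega
  obtain ⟨r, hr, hFr⟩ := hstab
  refine ⟨F r, (hball r).trans (pow_insert_mono hr), hone r, hmem r, fun γ hγ s hs h => ?_⟩
  rw [← hFr, hsucc]
  exact mem_union_right _ (mem_filter.2 ⟨mul_mem_mul hs hγ, h⟩)

/-- Small sets of good points inherit the isoperimetric inequality of the group. -/
lemma isoperimetric_of_good (hsym : ∀ s ∈ S, s⁻¹ ∈ S) {c : ℝ}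
    (hc : ∀ F : Finset Γ, c * F.card ≤ ∑ s ∈ S, ((F.filter fun γ => s * γ ∉ F).card : ℝ))
    {K : ℕ} (C : Finset V) (hC : C.card ≤ K)
    (hgood : ∀ x ∈ C, x ∉ bad σ ((insert 1 S) ^ (2 * (K + 1)))) :
    c * C.card ≤ ∑ s ∈ S, ((C.filter fun x => σ s x ∉ C).card : ℝ) := by
  induction C using Finset.strongInduction with
  | H C ih =>
  rcases C.eq_empty_or_nonempty with rfl | ⟨p, hp⟩
  · simp
  have hS : ∀ s ∈ S, s ∈ (insert 1 S) ^ (2 * (K + 1)) := fun s hs =>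
    pow_insert_mono (m := 1) (by omega) (by rw [pow_one]; exact mem_insert_of_mem hs)
  have hpg := hgood p hp
  obtain ⟨F, hFball, h1F, hFC, hclosed⟩ := exists_component_lift hsym hp hC hpg
  have hact : ∀ s ∈ S, ∀ γ ∈ F, σ s (σ γ p) = σ (s * γ) p := fun s hs γ hγ =>
    (notMem_bad.1 hpg).1 s (hS s hs) γ (pow_insert_mono (by omega) (hFball hγ))
  have hinj := injOn_orbit_map hsym hpg
  have hFball' : F ⊆ (insert 1 S) ^ (K + 1) := hFball.trans (pow_insert_mono (by omega))
  have hinjF : Set.InjOn (fun γ => σ γ p) (F : Set Γ) := hinj.mono (by exact_mod_cast hFball')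
  set D := F.image fun γ => σ γ p with hD
  have hDC : D ⊆ C := image_subset_iff.2 hFC
  have hpD : p ∈ D := mem_image.2 ⟨1, h1F, map_one_of_notMem_bad (one_mem_pow_insert _) hpg⟩
  have hDclosed : ∀ s ∈ S, ∀ x ∈ D, σ s x ∈ C → σ s x ∈ D := by
    intro s hs x hx hsx
    obtain ⟨γ, hγ, rfl⟩ := mem_image.1 hx
    rw [hact s hs γ hγ] at hsx ⊢
    exact mem_image_of_mem (fun γ => σ γ p) (hclosed γ hγ s hs hsx)
  have hDcoclosed : ∀ s ∈ S, ∀ x ∈ C, σ s x ∈ D → x ∈ D := by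
    intro s hs x hx hsx
    have h := (notMem_bad.1 (hgood x hx)).1 s⁻¹ (hS _ (hsym s hs)) s (hS s hs)
    rw [inv_mul_cancel, map_one_of_notMem_bad (one_mem_pow_insert _) (hgood x hx)] at h
    have := hDclosed s⁻¹ (hsym s hs) _ hsx (by rwa [h])
    rwa [h] at this
  have hbd : c * D.card ≤ ∑ s ∈ S, ((D.filter fun x => σ s x ∉ C).card : ℝ) := by
    rw [hD, card_image_of_injOn hinjF, ← hD]
    refine (hc F).trans (sum_le_sum fun s hs => ?_)
    have : (F.filter fun γ => s * γ ∉ F).card ≤ (D.filter fun x => σ s x ∉ C).card := by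
      refine card_le_card_of_injOn (fun γ => σ γ p) (fun γ hγ => ?_)
        (hinjF.mono (by exact_mod_cast filter_subset _ _))
      obtain ⟨hγF, hsγ⟩ := mem_filter.1 (mem_coe.1 hγ)
      refine mem_coe.2 (mem_filter.2 ⟨mem_image_of_mem _ hγF, fun hmem => hsγ ?_⟩)
      rw [hact s hs γ hγF] at hmem
      exact hclosed γ hγF s hs hmem
    exact_mod_cast this
  have hrest := ih (C \ D) (sdiff_ssubset hDC ⟨p, hpD⟩)
    ((card_le_card sdiff_subset).trans hC) (fun x hx => hgood x (mem_sdiff.1 hx).1)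
  have hcardC : (C.card : ℝ) = (C \ D).card + D.card := by
    exact_mod_cast (card_sdiff_add_card_eq_card hDC).symm
  rw [hcardC, mul_add]
  refine (add_le_add hrest hbd).trans ?_
  rw [← sum_add_distrib]
  refine sum_le_sum fun s hs => ?_
  have hdisj : Disjoint ((C \ D).filter fun x => σ s x ∉ C \ D)
      (D.filter fun x => σ s x ∉ C) :=
    disjoint_filter_filter sdiff_disjoint
  have hsub : ((C \ D).filter fun x => σ s x ∉ C \ D) ∪ (D.filter fun x => σ s x ∉ C) ⊆
      C.filter fun x => σ s x ∉ C := by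
    intro x hx
    rcases mem_union.1 hx with h | h
    · obtain ⟨hx1, hx2⟩ := mem_filter.1 h
      obtain ⟨hxC, hxD⟩ := mem_sdiff.1 hx1
      refine mem_filter.2 ⟨hxC, fun hsC => hx2 (mem_sdiff.2 ⟨hsC, fun hsD => hxD ?_⟩)⟩
      exact hDcoclosed s hs x hxC hsD
    · exact mem_filter.2 ⟨hDC (mem_filter.1 h).1, (mem_filter.1 h).2⟩
  have := card_le_card hsub
  rw [card_union_of_disjoint hdisj] at this
  exact_mod_cast this

/-- Any partition into small blocks is crossed by many edges. -/
lemma card_crossing_ge (hsym : ∀ s ∈ S, s⁻¹ ∈ S) {c : ℝ} (hc0 : 0 ≤ c)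
    (hc : ∀ F : Finset Γ, c * F.card ≤ ∑ s ∈ S, ((F.filter fun γ => s * γ ∉ F).card : ℝ))
    {K : ℕ} (b : V → ℕ) (hb : ∀ i, (univ.filter fun x => b x = i).card ≤ K) :
    c * (Fintype.card V - K * (bad σ ((insert 1 S) ^ (2 * (K + 1)))).card) ≤
      ∑ s ∈ S, ((univ.filter fun x => b (σ s x) ≠ b x).card : ℝ) := by
  set B := bad σ ((insert 1 S) ^ (2 * (K + 1))) with hB
  let C : ℕ → Finset V := fun i => univ.filter fun x => b x = i
  set I := univ.image b with hI
  set J := B.image b with hJ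
  have hJI : J ⊆ I := image_subset_image (subset_univ _)
  have htotal : Fintype.card V = ∑ i ∈ I, (C i).card :=
    card_eq_sum_card_image b univ
  have hJle : ∑ i ∈ J, (C i).card ≤ K * B.card := by
    calc ∑ i ∈ J, (C i).card ≤ J.card * K := by
          rw [← smul_eq_mul]
          exact sum_le_card_nsmul J (fun i => (C i).card) K fun i _ => hb i
      _ ≤ K * B.card := by rw [mul_comm]; exact Nat.mul_le_mul_left _ card_image_le
  have hgood : ∀ i ∈ I \ J, c * (C i).card ≤
      ∑ s ∈ S, (((C i).filter fun x => σ s x ∉ C i).card : ℝ) := fun i hi =>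
    isoperimetric_of_good hsym hc (C i) (hb i) fun x hx hxB =>
      (mem_sdiff.1 hi).2 (mem_image.2 ⟨x, hxB, (mem_filter.1 hx).2⟩)
  have hcover : (Fintype.card V : ℝ) - K * B.card ≤ ∑ i ∈ I \ J, ((C i).card : ℝ) := by
    have := sum_sdiff (f := fun i => (C i).card) hJI
    have h : Fintype.card V ≤ ∑ i ∈ I \ J, (C i).card + K * B.card := by omega
    have h' : (Fintype.card V : ℝ) ≤ ∑ i ∈ I \ J, ((C i).card : ℝ) + K * B.card := by
      exact_mod_cast h
    linarith
  calc c * (Fintype.card V - K * B.card) ≤ c * ∑ i ∈ I \ J, ((C i).card : ℝ) :=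
      mul_le_mul_of_nonneg_left hcover hc0
    _ ≤ ∑ i ∈ I \ J, ∑ s ∈ S, (((C i).filter fun x => σ s x ∉ C i).card : ℝ) := by
      rw [mul_sum]
      exact sum_le_sum hgood
    _ ≤ ∑ i ∈ I, ∑ s ∈ S, (((C i).filter fun x => σ s x ∉ C i).card : ℝ) :=
      sum_le_sum_of_subset_of_nonneg sdiff_subset fun _ _ _ =>
        sum_nonneg fun _ _ => Nat.cast_nonneg _
    _ = ∑ s ∈ S, ∑ i ∈ I, (((C i).filter fun x => σ s x ∉ C i).card : ℝ) := sum_comm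
    _ = ∑ s ∈ S, ((univ.filter fun x => b (σ s x) ≠ b x).card : ℝ) := by
      refine sum_congr rfl fun s _ => ?_
      have h := card_eq_sum_card_fiberwise (f := b) (s := univ.filter fun x => b (σ s x) ≠ b x)
        (t := I) fun x _ => mem_coe.2 (mem_image_of_mem b (mem_univ x))
      rw [h, Nat.cast_sum]
      refine sum_congr rfl fun i _ => ?_
      congr 2
      ext x
      simp only [C, mem_filter, mem_univ, true_and]
      constructor
      · rintro ⟨rfl, h⟩
        exact ⟨h, rfl⟩
      · rintro ⟨h, rfl⟩
        exact ⟨rfl, h⟩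

end Isoperimetry

section Amplification

variable {Γ : Type*} [Group Γ]

/-- Disjoint copies of an action on `N` points, padded by fixed points. -/
lemma exists_amplification {N : ℕ} (hN : 0 < N) (σ : Γ → Equiv.Perm (Fin N)) (n : ℕ) :
    ∃ (ψ : Γ → Equiv.Perm (Fin n)) (b : Fin n → ℕ), (∀ γ x, b (ψ γ x) = b x) ∧
      (∀ i, (univ.filter fun x => b x = i).card ≤ N) ∧
      ∀ T : Finset Γ, (bad ψ T).card ≤ n / N * (bad σ T).card + N := by
  classical
  have hcard : Fintype.card (Fin n) = Fintype.card (Fin (n / N) × Fin N ⊕ Fin (n % N)) := by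
    simp [Nat.div_add_mod']
  let e := Fintype.equivOfCardEq hcard
  have hmod := (Nat.mod_lt n hN).le
  let ψ : Γ → Equiv.Perm (Fin n) := fun γ =>
    e.symm.permCongr (Equiv.sumCongr (Equiv.prodCongr (Equiv.refl _) (σ γ)) (Equiv.refl _))
  let b : Fin n → ℕ := fun x => Sum.elim (fun q => (q.1 : ℕ)) (fun _ => n / N) (e x)
  have hψl : ∀ γ q y, ψ γ (e.symm (Sum.inl (q, y))) = e.symm (Sum.inl (q, σ γ y)) := by
    intro γ q y
    simp [ψ, Equiv.permCongr_apply]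
  have hψr : ∀ γ y, ψ γ (e.symm (Sum.inr y)) = e.symm (Sum.inr y) := by
    intro γ y
    simp [ψ, Equiv.permCongr_apply]
  refine ⟨ψ, b, ?_, ?_, ?_⟩
  · intro γ x
    obtain ⟨z, rfl⟩ := e.symm.surjective x
    rcases z with ⟨q, y⟩ | y
    · rw [hψl]
      simp [b]
    · rw [hψr]
  · intro i
    by_cases hi : i < n / N
    · have hsub : (univ.filter fun x => b x = i) ⊆
          univ.image fun y : Fin N => e.symm (Sum.inl (⟨i, hi⟩, y)) := by
        intro x hx
        obtain ⟨z, rfl⟩ := e.symm.surjective x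
        rcases z with ⟨q, y⟩ | y
        · have : (q : ℕ) = i := by simpa [b] using hx
          exact mem_image.2 ⟨y, mem_univ _, by subst this; rfl⟩
        · have : n / N = i := by simpa [b] using hx
          omega
      simpa using (card_le_card hsub).trans card_image_le
    · have hsub : (univ.filter fun x => b x = i) ⊆
          univ.image fun y : Fin (n % N) => e.symm (Sum.inr y) := by
        intro x hx
        obtain ⟨z, rfl⟩ := e.symm.surjective x
        rcases z with ⟨q, y⟩ | y
        · have : (q : ℕ) = i := by simpa [b] using hx
          exact absurd (this ▸ q.2) hi
        · exact mem_image_of_mem _ (mem_univ _)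
      exact (by simpa using (card_le_card hsub).trans card_image_le : _ ≤ n % N).trans hmod
  · intro T
    have hsub : bad ψ T ⊆ (((univ : Finset (Fin (n / N))) ×ˢ bad σ T).image
        fun z => e.symm (Sum.inl z)) ∪ univ.image fun y : Fin (n % N) => e.symm (Sum.inr y) := by
      intro x hx
      obtain ⟨z, rfl⟩ := e.symm.surjective x
      rcases z with ⟨q, y⟩ | y
      · refine mem_union_left _ (mem_image.2 ⟨(q, y), mem_product.2 ⟨mem_univ _, ?_⟩, rfl⟩)
        by_contra hy
        rw [notMem_bad] at hy
        refine notMem_bad.2 ⟨fun γ hγ δ hδ => ?_, fun γ hγ h1 h => hy.2 γ hγ h1 ?_⟩ hx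
        · rw [hψl, hψl, hψl, hy.1 γ hγ δ hδ]
        · rw [hψl] at h
          simpa using h
      · exact mem_union_right _ (mem_image_of_mem _ (mem_univ _))
    refine (card_le_card hsub).trans ((card_union_le _ _).trans (add_le_add ?_ ?_))
    · exact card_image_le.trans (by simp [card_product])
    · exact card_image_le.trans (by simpa using hmod)

end Amplification

/-- Diagonalization along a filter finer than the cofinite one. -/
lemma exists_diagonal {l : Filter ℕ} (hl : l ≤ cofinite) {P : ℕ → ℕ → Prop}
    (hP : ∀ k, ∀ᶠ n in l, P k n) :
    ∃ κ : ℕ → ℕ, Tendsto κ l atTop ∧ ∀ᶠ n in l, P (κ n) n := by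
  classical
  refine ⟨fun n => Nat.findGreatest (P · n) n, tendsto_atTop.2 fun j => ?_, ?_⟩
  · have hj : ∀ᶠ n in l, j ≤ n :=
      hl (by rw [Nat.cofinite_eq_atTop]; exact eventually_ge_atTop j)
    filter_upwards [hP j, hj] with n h1 h2
    exact Nat.le_findGreatest h2 h1
  · filter_upwards [hP 0] with n hn
    exact Nat.findGreatest_spec (P := (P · n)) (Nat.zero_le n) hn

end SoficConjugacy

open SoficConjugacy Pointwise in
/-- A finitely generated nonamenable sofic group `Γ` admits two faithful
embeddings into the metric ultraproduct `Σ = (∏ₙ Sₙ)/H` that are not conjugate by any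
element of `Σ`. -/
theorem nonamenable_has_nonconjugate_embeddings {Γ : Type} [Group Γ] [DecidableEq Γ]
    (ω : Ultrafilter ℕ) (hω : (ω : Filter ℕ) ≤ Filter.cofinite)
    (S : Finset Γ) (hsym : ∀ s ∈ S, s⁻¹ ∈ S)
    (hgen : Subgroup.closure (S : Set Γ) = ⊤)
    (hnonamen : ¬ ∃ F : ℕ → Finset Γ, IsFolnerSeq S F)
    (hsofic : ∃ φ : Γ → ∀ n : ℕ, Equiv.Perm (Fin n), IsSoficRep ω (fun n => n) φ) :
    ∃ φ ψ : Γ → ∀ n : ℕ, Equiv.Perm (Fin n),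
      IsSoficRep ω (fun n => n) φ ∧ IsSoficRep ω (fun n => n) ψ ∧
      ¬ ConjugateReps ω (fun n => n) φ ψ := by
  obtain ⟨φ, hφ⟩ := hsofic
  obtain ⟨c, hc0, hc⟩ := exists_isoperimetric_constant hsym hnonamen
  have hφ' := (isSoficRep_iff hω φ).1 hφ
  have hsmall : ∀ k : ℕ, ∃ N : ℕ, 0 < N ∧
      ((bad (fun γ => φ γ N) ((insert 1 S) ^ k)).card : ℝ) ≤ 1 / ((k : ℝ) + 1) * N := fun k =>
    ((eventually_pos hω).and (hφ' ((insert 1 S) ^ k) (1 / ((k : ℝ) + 1)) (by positivity))).exists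
  choose N hN hNbad using hsmall
  choose ψ b hbψ hbN hψbad using fun k n => exists_amplification (hN k) (fun γ => φ γ (N k)) n
  obtain ⟨κ, hκ, hκP⟩ := exists_diagonal hω (P := fun k n => (k + 1) * N k ≤ n ∧
      ((bad (fun γ => φ γ n) ((insert 1 S) ^ (2 * (N k + 1)))).card : ℝ) ≤ 1 / (2 * N k) * n) fun k => by
    have hNk : (0 : ℝ) < N k := by exact_mod_cast hN k
    refine Eventually.and ?_ (hφ' _ _ (by positivity))
    exact hω (by rw [Nat.cofinite_eq_atTop]; exact eventually_ge_atTop _)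
  refine ⟨φ, fun γ n => ψ (κ n) n γ, hφ, (isSoficRep_iff hω _).2 fun T ε hε => ?_, ?_⟩
  · obtain ⟨k₀, hk₀⟩ := exists_subset_pow_insert hsym hgen T
    obtain ⟨k₁, hk₁⟩ := exists_nat_gt (2 / ε)
    filter_upwards [hκ.eventually_ge_atTop k₀, hκ.eventually_ge_atTop k₁, hκP]
      with n h0 h1 ⟨hn, _⟩
    have hsub := Finset.card_le_card
      (bad_mono (σ := ψ (κ n) n) (hk₀.trans (pow_insert_mono h0)))
    have hNpos : (0 : ℝ) < N (κ n) := by exact_mod_cast hN (κ n)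
    have hk : (0 : ℝ) < (κ n : ℝ) + 1 := by positivity
    have hdiv : ((n / N (κ n) : ℕ) : ℝ) * N (κ n) ≤ n := by
      exact_mod_cast Nat.div_mul_le_self n (N (κ n))
    have hn' : ((κ n : ℝ) + 1) * N (κ n) ≤ n := by exact_mod_cast hn
    have hκε : 2 / ((κ n : ℝ) + 1) ≤ ε := by
      have : (k₁ : ℝ) ≤ κ n := by exact_mod_cast h1
      rw [div_le_iff₀ hk]
      rw [div_lt_iff₀ hε] at hk₁
      nlinarith
    calc ((bad (ψ (κ n) n) T).card : ℝ)
        ≤ (n / N (κ n) : ℕ) * (bad (fun γ => φ γ (N (κ n))) ((insert 1 S) ^ κ n)).card + N (κ n) := by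
          exact_mod_cast hsub.trans (hψbad (κ n) n _)
      _ ≤ (n / N (κ n) : ℕ) * (1 / ((κ n : ℝ) + 1) * N (κ n)) + N (κ n) := by
          gcongr
          exact hNbad _
      _ = 1 / ((κ n : ℝ) + 1) * ((n / N (κ n) : ℕ) * N (κ n) + ((κ n : ℝ) + 1) * N (κ n)) := by
          field_simp
      _ ≤ 1 / ((κ n : ℝ) + 1) * (n + n) := by gcongr
      _ = 2 / ((κ n : ℝ) + 1) * n := by ring
      _ ≤ ε * n := by gcongr
  · rintro ⟨g, hg⟩
    have hsum := tendsto_finsetSum S fun s _ => hg s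
    rw [Finset.sum_const_zero] at hsum
    obtain ⟨n, hlt, hn, _, hbad⟩ :=
      ((hsum.eventually_lt_const (half_pos hc0)).and ((eventually_pos hω).and hκP)).exists
    have hn' : (0 : ℝ) < n := by exact_mod_cast hn
    have hNpos : (0 : ℝ) < N (κ n) := by exact_mod_cast hN (κ n)
    have hblock : ∀ i, (Finset.univ.filter fun x => b (κ n) n ((g n)⁻¹ x) = i).card ≤ N (κ n) := by
      intro i
      refine le_trans (Finset.card_le_card_of_injOn (fun x => (g n)⁻¹ x) (fun x hx => ?_)
        (g n)⁻¹.injective.injOn) (hbN (κ n) n i)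
      simpa using hx
    have hcross := card_crossing_ge (σ := fun γ => φ γ n) hsym hc0.le hc _ hblock
    have hle : ∀ s ∈ S, ((Finset.univ.filter fun x =>
        b (κ n) n ((g n)⁻¹ (φ s n x)) ≠ b (κ n) n ((g n)⁻¹ x)).card : ℝ) ≤
        rk ((g n * ψ (κ n) n s * (g n)⁻¹)⁻¹ * φ s n) * n := by
      intro s _
      rw [rk_inv_mul_eq_card hn]
      norm_cast
      refine Finset.card_le_card fun x hx => ?_
      simp only [Finset.mem_filter, Finset.mem_univ, true_and] at hx ⊢
      intro h
      apply hx
      rw [← h]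
      simp [Equiv.Perm.mul_apply, hbψ]
    have hupper := hcross.trans (Finset.sum_le_sum hle)
    rw [← Finset.sum_mul, Fintype.card_fin] at hupper
    have h1 : (N (κ n) : ℝ) * (bad (fun γ => φ γ n) ((insert 1 S) ^ (2 * (N (κ n) + 1)))).card ≤ n / 2 := by
      calc _ ≤ (N (κ n) : ℝ) * (1 / (2 * N (κ n)) * n) := by gcongr
        _ = n / 2 := by field_simp
    have h2 : c * (n / 2) ≤ c * (n - N (κ n) *
        (bad (fun γ => φ γ n) ((insert 1 S) ^ (2 * (N (κ n) + 1)))).card) := by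
      gcongr
      linarith
    have h3 := mul_lt_mul_of_pos_right hlt hn'
    have h4 := h2.trans hupper
    linarith
end

section
/- Let Γ be a finitely generated amenable group. Then any two faithful embeddings φ, ψ : Γ → Σ into the metric ultraproduct of finite symmetric groups are conjugate: there exists g ∈ Σ with g ψ(γ) g⁻¹ = φ(γ) for all γ ∈ Γ. -/
open Filter Topology

/-- The points of `A` which `σ` moves out of `A`. -/
def escape {X : Type*} [DecidableEq X] (σ : Equiv.Perm X) (A : Finset X) : Finset X :=
  A.filter (fun z => σ z ∉ A)

/-- `a` is multiplicative and free on `K` at the point `x`. -/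
def IsGoodPoint {Γ X : Type*} [Group Γ] (a : Γ → Equiv.Perm X) (K : Finset Γ) (x : X) : Prop :=
  (∀ k ∈ K, ∀ l ∈ K, a k (a l x) = a (k * l) x) ∧ Set.InjOn (fun k => a k x) K

/-- A partial bijection `pairs` between `left` and `right`, which together carry tiles of total
size `vol`, intertwining `a s` and `b s` for `s ∈ S` up to a small proportion of defects. -/
structure QuasiMatching {Γ X : Type*} [DecidableEq X] (S : Finset Γ) (ε : ℝ)
    (a b : Γ → Equiv.Perm X) where
  left : Finset X
  right : Finset X
  pairs : Finset (X × X)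
  vol : ℕ
  fst_injOn : Set.InjOn Prod.fst (pairs : Set (X × X))
  snd_injOn : Set.InjOn Prod.snd (pairs : Set (X × X))
  pairs_subset : pairs ⊆ left ×ˢ right
  left_card : left.card ≤ vol
  right_card : right.card ≤ vol
  pairs_card : (1 - 2 * ε) * vol ≤ pairs.card
  defect : ∀ s ∈ S,
    ((pairs.filter fun p => (a s p.1, b s p.2) ∉ pairs).card : ℝ) ≤ 3 * ε * vol

/-- The trivial quasi-matching. -/
def QuasiMatching.empty {Γ X : Type*} [DecidableEq X] (S : Finset Γ) (ε : ℝ)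
    (a b : Γ → Equiv.Perm X) : QuasiMatching S ε a b where
  left := ∅
  right := ∅
  pairs := ∅
  vol := 0
  fst_injOn := by simp
  snd_injOn := by simp
  pairs_subset := by simp
  left_card := by simp
  right_card := by simp
  pairs_card := by simp
  defect := by simp

section Tiling

variable {Γ X : Type*} [DecidableEq X]

lemma QuasiMatching.pairs_card_le [Fintype X] {S : Finset Γ} {ε : ℝ} {a b : Γ → Equiv.Perm X}
    (m : QuasiMatching S ε a b) : m.pairs.card ≤ Fintype.card X := by
  rw [← Finset.card_image_of_injOn m.fst_injOn]
  exact Finset.card_le_univ _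

lemma QuasiMatching.vol_le [Fintype X] {S : Finset Γ} {ε : ℝ} (hε : ε ≤ 1 / 4)
    {a b : Γ → Equiv.Perm X} (m : QuasiMatching S ε a b) :
    (m.vol : ℝ) ≤ 2 * Fintype.card X := by
  have h1 := m.pairs_card
  have h2 : (m.pairs.card : ℝ) ≤ Fintype.card X := by exact_mod_cast m.pairs_card_le
  nlinarith [(Nat.cast_nonneg m.vol : (0 : ℝ) ≤ m.vol)]

/-- A quasi-matching is close to a permutation almost conjugating `b s` to `a s`. -/
lemma QuasiMatching.exists_perm [Fintype X] {S : Finset Γ} {ε : ℝ} {a b : Γ → Equiv.Perm X}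
    (m : QuasiMatching S ε a b) : ∃ g : Equiv.Perm X, ∀ s ∈ S,
      ((Finset.univ.filter fun x => g (b s x) ≠ a s (g x)).card : ℝ) ≤
        (Fintype.card X - m.pairs.card) + 3 * ε * m.vol := by
  have hex : ∀ y ∈ m.pairs.image Prod.snd, ∃ x, (x, y) ∈ m.pairs := by
    intro y hy
    obtain ⟨p, hp, rfl⟩ := Finset.mem_image.1 hy
    exact ⟨p.1, hp⟩
  choose! h hh using hex
  have hinj : Set.InjOn h (m.pairs.image Prod.snd : Finset X) := by
    intro y hy z hz hyz
    have h1 := hh y hy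
    have h2 := hh z hz
    rw [← hyz] at h2
    exact (Prod.ext_iff.1 (m.fst_injOn h1 h2 rfl)).2
  obtain ⟨g', hg'⟩ := Finset.exists_equiv_extend_of_card_eq (t := (Finset.univ : Finset X))
    Finset.card_univ.symm (Finset.subset_univ _) hinj
  let g : Equiv.Perm X := g'.trans ⟨fun z => z.1, fun z => ⟨z, Finset.mem_univ _⟩,
    fun _ => rfl, fun _ => rfl⟩
  have hg : ∀ p ∈ m.pairs, g p.2 = p.1 := by
    intro p hp
    have hy : p.2 ∈ m.pairs.image Prod.snd := Finset.mem_image_of_mem _ hp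
    have h1 : g p.2 = h p.2 := hg' _ hy
    have h2 := m.snd_injOn (hh _ hy) hp rfl
    rw [h1]
    exact (Prod.ext_iff.1 h2).1
  refine ⟨g, fun s hs => ?_⟩
  have hsub : (Finset.univ.filter fun x => g (b s x) ≠ a s (g x)) ⊆
      (m.pairs.image Prod.snd)ᶜ ∪
        (m.pairs.filter fun p => (a s p.1, b s p.2) ∉ m.pairs).image Prod.snd := by
    intro x hx
    rw [Finset.mem_filter] at hx
    rw [Finset.mem_union, Finset.mem_compl]
    by_cases hxM : x ∈ m.pairs.image Prod.snd
    · right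
      obtain ⟨p, hp, rfl⟩ := Finset.mem_image.1 hxM
      refine Finset.mem_image.2 ⟨p, Finset.mem_filter.2 ⟨hp, fun hq => hx.2 ?_⟩, rfl⟩
      rw [hg p hp]
      exact hg _ hq
    · exact Or.inl hxM
  have hcard := (Finset.card_le_card hsub).trans ((Finset.card_union_le _ _).trans
    (Nat.add_le_add_left Finset.card_image_le _))
  have hcompl := Finset.card_compl_add_card (m.pairs.image Prod.snd)
  rw [Finset.card_image_of_injOn m.snd_injOn] at hcompl
  have hcard' : ((Finset.univ.filter fun x => g (b s x) ≠ a s (g x)).card : ℝ) ≤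
    ((m.pairs.image Prod.snd)ᶜ).card +
      (m.pairs.filter fun p => (a s p.1, b s p.2) ∉ m.pairs).card := by exact_mod_cast hcard
  have hcompl' : (((m.pairs.image Prod.snd)ᶜ).card : ℝ) + m.pairs.card = Fintype.card X := by
    exact_mod_cast hcompl
  linarith [m.defect s hs]

lemma card_filter_escape [Fintype X] (σ : Equiv.Perm X) (A : Finset X) :
    (Finset.univ.filter fun x => x ∉ A ∧ σ x ∈ A).card = (escape σ A).card := by
  have h1 : (Finset.univ.filter fun x => σ x ∈ A).card = A.card := by
    have : (Finset.univ.filter fun x => σ x ∈ A) = A.image σ.symm := by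
      ext x
      simp only [Finset.mem_filter, Finset.mem_univ, true_and, Finset.mem_image]
      exact ⟨fun h => ⟨σ x, h, by simp⟩, by rintro ⟨z, hz, rfl⟩; simpa using hz⟩
    rw [this, Finset.card_image_of_injective _ σ.symm.injective]
  have h2 := Finset.card_filter_add_card_filter_not (s := A) (fun x => σ x ∈ A)
  have h3 := Finset.card_filter_add_card_filter_not
    (s := Finset.univ.filter fun x => σ x ∈ A) (fun x => x ∈ A)
  rw [Finset.filter_filter, Finset.filter_filter] at h3
  have h4 : (Finset.univ.filter fun x => σ x ∈ A ∧ x ∈ A) = A.filter (fun x => σ x ∈ A) := by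
    ext x
    simp [and_comm]
  rw [h4] at h3
  have h5 : (Finset.univ.filter fun x => σ x ∈ A ∧ x ∉ A) =
      (Finset.univ.filter fun x => x ∉ A ∧ σ x ∈ A) := by
    ext x
    simp [and_comm]
  rw [h5] at h3
  unfold escape
  omega

variable [Group Γ]

/-- If every good point has a tile meeting `A` substantially, and `A₀ ⊆ A` is nearly invariant
under the tile, then the complement of `A` is smaller than that of `A₀` by a definite factor. -/
lemma card_compl_le_of_saturated [Fintype X] {a : Γ → Equiv.Perm X} {F T : Finset Γ}
    (hF : F.Nonempty) {A₀ A : Finset X} (hA : A₀ ⊆ A) {ε c d : ℝ} (hε0 : 0 ≤ ε) (hε : ε ≤ 1)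
    (hbad : ∃ E : Finset X, (E.card : ℝ) ≤ d ∧ ∀ x ∉ E, IsGoodPoint a T x)
    (hesc : ∀ f ∈ F, ((escape (a f) A₀).card : ℝ) ≤ c)
    (hsat : ∀ x, IsGoodPoint a T x →
      ε * F.card < ((F.filter fun f => a f x ∈ A).card : ℝ)) :
    ((Aᶜ).card : ℝ) ≤ (1 - ε) * (A₀ᶜ).card + (c + d) := by
  obtain ⟨E, hE, hgood⟩ := hbad
  have hd : 0 ≤ d := le_trans (by positivity) hE
  have hFpos : (0 : ℝ) < F.card := by exact_mod_cast hF.card_pos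
  have hlow : ε * F.card * (((A₀ᶜ).card : ℝ) - d) ≤
      ∑ x ∈ A₀ᶜ, ((F.filter fun f => a f x ∈ A).card : ℝ) := by
    calc ε * F.card * (((A₀ᶜ).card : ℝ) - d) ≤ ε * F.card * ((A₀ᶜ \ E).card : ℝ) := by
          have h : (A₀ᶜ).card ≤ (A₀ᶜ \ E).card + E.card := by
            have := Finset.le_card_sdiff E (A₀ᶜ)
            omega
          have h' : ((A₀ᶜ).card : ℝ) ≤ (A₀ᶜ \ E).card + E.card := by exact_mod_cast h
          gcongr
          linarith
      _ = ∑ x ∈ A₀ᶜ \ E, ε * F.card := by rw [Finset.sum_const, nsmul_eq_mul, mul_comm]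
      _ ≤ ∑ x ∈ A₀ᶜ \ E, ((F.filter fun f => a f x ∈ A).card : ℝ) :=
          Finset.sum_le_sum fun x hx => (hsat x (hgood x (Finset.mem_sdiff.1 hx).2)).le
      _ ≤ _ := Finset.sum_le_sum_of_subset_of_nonneg Finset.sdiff_subset
          fun _ _ _ => Nat.cast_nonneg _
  have hswap : ∑ x ∈ A₀ᶜ, ((F.filter fun f => a f x ∈ A).card : ℝ) =
      ∑ f ∈ F, (((A₀ᶜ).filter fun x => a f x ∈ A).card : ℝ) := by
    have := Finset.sum_card_bipartiteAbove_eq_sum_card_bipartiteBelow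
      (s := A₀ᶜ) (t := F) (fun x f => a f x ∈ A)
    simp only [Finset.bipartiteAbove, Finset.bipartiteBelow] at this
    exact_mod_cast this
  have hup : ∀ f ∈ F, (((A₀ᶜ).filter fun x => a f x ∈ A).card : ℝ) ≤ (A \ A₀).card + c := by
    intro f hf
    have hsub : ((A₀ᶜ).filter fun x => a f x ∈ A) ⊆ (A \ A₀).image (a f).symm ∪
        (Finset.univ.filter fun x => x ∉ A₀ ∧ a f x ∈ A₀) := by
      intro x hx
      rw [Finset.mem_filter, Finset.mem_compl] at hx
      rw [Finset.mem_union]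
      by_cases h : a f x ∈ A₀
      · exact Or.inr (by simp [hx.1, h])
      · exact Or.inl (Finset.mem_image.2 ⟨a f x, by simp [hx.2, h], by simp⟩)
    have h1 := (Finset.card_le_card hsub).trans ((Finset.card_union_le _ _).trans
      (Nat.add_le_add_right Finset.card_image_le _))
    rw [card_filter_escape] at h1
    have h2 : (((A₀ᶜ).filter fun x => a f x ∈ A).card : ℝ) ≤
      (A \ A₀).card + (escape (a f) A₀).card := by exact_mod_cast h1
    linarith [hesc f hf]
  have hsum : ∑ f ∈ F, (((A₀ᶜ).filter fun x => a f x ∈ A).card : ℝ) ≤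
      F.card * ((A \ A₀).card + c) := by
    refine (Finset.sum_le_sum hup).trans ?_
    rw [Finset.sum_const, nsmul_eq_mul]
  have hkey : ε * (((A₀ᶜ).card : ℝ) - d) ≤ (A \ A₀).card + c := by
    have : F.card * (ε * (((A₀ᶜ).card : ℝ) - d)) ≤ F.card * (((A \ A₀).card : ℝ) + c) := by
      rw [hswap] at hlow
      linarith
    exact le_of_mul_le_mul_left this hFpos
  have hdiff : ((A \ A₀).card : ℝ) + (Aᶜ).card = (A₀ᶜ).card := by
    have h1 : (A \ A₀).card + A₀.card = A.card := Finset.card_sdiff_add_card_eq_card hA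
    have h2 := Finset.card_add_card_compl A
    have h3 := Finset.card_add_card_compl A₀
    have : (A \ A₀).card + (Aᶜ).card = (A₀ᶜ).card := by omega
    exact_mod_cast this
  nlinarith

variable [DecidableEq Γ]

/-- Adding a tile to a set increases the number of escaping points by at most the boundary of
the tile. -/
lemma card_escape_union_tile {a : Γ → Equiv.Perm X} {T F : Finset Γ} {x : X}
    (hx : IsGoodPoint a T x) (hFT : F ⊆ T) {k : Γ} (hk : k ∈ T) (A : Finset X) :
    (escape (a k) (A ∪ F.image (fun f => a f x))).card ≤
      (escape (a k) A).card + (F.filter fun f => k * f ∉ F).card := by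
  refine (Finset.card_le_card (t := escape (a k) A ∪
    (F.filter fun f => k * f ∉ F).image (fun f => a f x)) ?_).trans
    ((Finset.card_union_le _ _).trans (Nat.add_le_add_left Finset.card_image_le _))
  intro z hz
  simp only [escape, Finset.mem_filter, Finset.mem_union, Finset.mem_image, not_or,
    not_exists, not_and] at hz ⊢
  obtain ⟨hz | ⟨f, hf, rfl⟩, h1, h2⟩ := hz
  · exact Or.inl ⟨hz, h1⟩
  · refine Or.inr ⟨f, ⟨hf, fun h => h2 _ h ?_⟩, rfl⟩
    exact (hx.1 k hk f (hFT hf)).symm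

/-- A quasi-matching can be enlarged by a pair of tiles which are almost disjoint from it. -/
lemma QuasiMatching.exists_add_tile {S : Finset Γ} {ε : ℝ} {a b : Γ → Equiv.Perm X}
    (m : QuasiMatching S ε a b) {T F : Finset Γ} {x y : X}
    (hx : IsGoodPoint a T x) (hy : IsGoodPoint b T y) (hFT : F ⊆ T) (hST : S ⊆ T)
    (hFS : ∀ s ∈ S, ((F.filter fun f => s * f ∉ F).card : ℝ) ≤ ε * F.card)
    (hxA : ((F.filter fun f => a f x ∈ m.left).card : ℝ) ≤ ε * F.card)
    (hyB : ((F.filter fun f => b f y ∈ m.right).card : ℝ) ≤ ε * F.card) :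
    ∃ m' : QuasiMatching S ε a b, m'.left = m.left ∪ F.image (fun f => a f x) ∧
      m'.right = m.right ∪ F.image (fun f => b f y) ∧ m'.vol = m.vol + F.card := by
  set F' := F.filter (fun f => a f x ∉ m.left ∧ b f y ∉ m.right) with hF'
  set N := F'.image (fun f => (a f x, b f y)) with hN
  have hF'F : ∀ f ∈ F', f ∈ F := fun f hf => (Finset.mem_filter.1 hf).1
  have hxinj : ∀ f ∈ F', ∀ g ∈ F', a f x = a g x → f = g := fun f hf g hg h =>
    hx.2 (hFT (hF'F f hf)) (hFT (hF'F g hg)) h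
  have hyinj : ∀ f ∈ F', ∀ g ∈ F', b f y = b g y → f = g := fun f hf g hg h =>
    hy.2 (hFT (hF'F f hf)) (hFT (hF'F g hg)) h
  have hNcard : N.card = F'.card :=
    Finset.card_image_of_injOn fun f hf g hg h => hxinj f hf g hg (Prod.ext_iff.1 h).1
  have hMmem : ∀ p ∈ m.pairs, p.1 ∈ m.left ∧ p.2 ∈ m.right := fun p hp =>
    Finset.mem_product.1 (m.pairs_subset hp)
  have hNmem : ∀ p ∈ N, ∃ f ∈ F', p = (a f x, b f y) ∧ p.1 ∉ m.left ∧ p.2 ∉ m.right := by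
    intro p hp
    obtain ⟨f, hf, rfl⟩ := Finset.mem_image.1 hp
    exact ⟨f, hf, rfl, (Finset.mem_filter.1 hf).2⟩
  have hcompl : ((F.filter fun f => f ∉ F').card : ℝ) ≤ 2 * ε * F.card := by
    have : F.filter (fun f => f ∉ F') ⊆
        (F.filter fun f => a f x ∈ m.left) ∪ (F.filter fun f => b f y ∈ m.right) := by
      intro f hf
      simp only [hF', Finset.mem_filter, Finset.mem_union] at hf ⊢
      tauto
    have h2 : ((F.filter fun f => f ∉ F').card : ℝ) ≤
        (F.filter fun f => a f x ∈ m.left).card + (F.filter fun f => b f y ∈ m.right).card := by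
      exact_mod_cast (Finset.card_le_card this).trans (Finset.card_union_le _ _)
    linarith
  have hF'card : (1 - 2 * ε) * F.card ≤ F'.card := by
    have h1 : (F.filter (fun f => f ∈ F')).card + (F.filter (fun f => f ∉ F')).card = F.card :=
      Finset.card_filter_add_card_filter_not _
    have h2 : F.filter (fun f => f ∈ F') = F' := by
      ext f
      simp only [Finset.mem_filter]
      exact ⟨fun h => h.2, fun h => ⟨hF'F f h, h⟩⟩
    rw [h2] at h1
    have h3 : (F'.card : ℝ) + (F.filter (fun f => f ∉ F')).card = F.card := by exact_mod_cast h1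
    linarith
  have hdisj : Disjoint m.pairs N := by
    rw [Finset.disjoint_left]
    intro p hp hpN
    obtain ⟨f, -, -, h, -⟩ := hNmem p hpN
    exact h (hMmem p hp).1
  refine ⟨⟨m.left ∪ F.image (fun f => a f x), m.right ∪ F.image (fun f => b f y), m.pairs ∪ N,
    m.vol + F.card, ?_, ?_, ?_, ?_, ?_, ?_, ?_⟩, rfl, rfl, rfl⟩
  · intro p hp q hq h
    rw [Finset.mem_coe, Finset.mem_union] at hp hq
    rcases hp with hp | hp <;> rcases hq with hq | hq
    · exact m.fst_injOn hp hq h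
    · obtain ⟨f, -, -, h', -⟩ := hNmem q hq
      exact absurd (h ▸ (hMmem p hp).1) h'
    · obtain ⟨f, -, -, h', -⟩ := hNmem p hp
      exact absurd (h ▸ (hMmem q hq).1) h'
    · obtain ⟨f, hf, rfl, -⟩ := hNmem p hp
      obtain ⟨g, hg, rfl, -⟩ := hNmem q hq
      rw [hxinj f hf g hg h]
  · intro p hp q hq h
    rw [Finset.mem_coe, Finset.mem_union] at hp hq
    rcases hp with hp | hp <;> rcases hq with hq | hq
    · exact m.snd_injOn hp hq h
    · obtain ⟨f, -, -, -, h'⟩ := hNmem q hq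
      exact absurd (h ▸ (hMmem p hp).2) h'
    · obtain ⟨f, -, -, -, h'⟩ := hNmem p hp
      exact absurd (h ▸ (hMmem q hq).2) h'
    · obtain ⟨f, hf, rfl, -⟩ := hNmem p hp
      obtain ⟨g, hg, rfl, -⟩ := hNmem q hq
      rw [hyinj f hf g hg h]
  · intro p hp
    rw [Finset.mem_union] at hp
    rw [Finset.mem_product, Finset.mem_union, Finset.mem_union]
    rcases hp with hp | hp
    · exact ⟨Or.inl (hMmem p hp).1, Or.inl (hMmem p hp).2⟩
    · obtain ⟨f, hf, rfl, -⟩ := hNmem p hp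
      exact ⟨Or.inr (Finset.mem_image_of_mem _ (hF'F f hf)),
        Or.inr (Finset.mem_image_of_mem (fun f => b f y) (hF'F f hf))⟩
  · exact (Finset.card_union_le _ _).trans (Nat.add_le_add m.left_card Finset.card_image_le)
  · exact (Finset.card_union_le _ _).trans (Nat.add_le_add m.right_card Finset.card_image_le)
  · rw [Finset.card_union_of_disjoint hdisj, hNcard]
    push_cast
    linarith [m.pairs_card]
  · intro s hs
    have hsub : ((m.pairs ∪ N).filter fun p => (a s p.1, b s p.2) ∉ m.pairs ∪ N) ⊆
        (m.pairs.filter fun p => (a s p.1, b s p.2) ∉ m.pairs) ∪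
        ((F.filter fun f => s * f ∉ F).image (fun f => (a f x, b f y)) ∪
        (F.filter fun f => f ∉ F').image (fun f => (a (s⁻¹ * f) x, b (s⁻¹ * f) y))) := by
      intro p hp
      rw [Finset.mem_filter, Finset.mem_union, Finset.mem_union, not_or] at hp
      obtain ⟨hp | hp, h1, h2⟩ := hp
      · exact Finset.mem_union_left _ (Finset.mem_filter.2 ⟨hp, h1⟩)
      · refine Finset.mem_union_right _ ?_
        obtain ⟨f, hf, rfl, -⟩ := hNmem p hp
        have hfF := hF'F f hf
        rw [Finset.mem_union]
        by_cases hsf : s * f ∈ F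
        · right
          refine Finset.mem_image.2 ⟨s * f, Finset.mem_filter.2 ⟨hsf, fun h => h2 ?_⟩, by simp⟩
          refine Finset.mem_image.2 ⟨s * f, h, ?_⟩
          simp only [hx.1 s (hST hs) f (hFT hfF), hy.1 s (hST hs) f (hFT hfF)]
        · left
          exact Finset.mem_image.2 ⟨f, Finset.mem_filter.2 ⟨hfF, hsf⟩, rfl⟩
    have hcard := (Finset.card_le_card hsub).trans ((Finset.card_union_le _ _).trans
      (Nat.add_le_add_left ((Finset.card_union_le _ _).trans
        (Nat.add_le_add Finset.card_image_le Finset.card_image_le)) _))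
    have hcard' : (((m.pairs ∪ N).filter fun p => (a s p.1, b s p.2) ∉ m.pairs ∪ N).card : ℝ) ≤
        (m.pairs.filter fun p => (a s p.1, b s p.2) ∉ m.pairs).card +
        ((F.filter fun f => s * f ∉ F).card + (F.filter fun f => f ∉ F').card) := by
      exact_mod_cast hcard
    push_cast
    linarith [m.defect s hs, hFS s hs]

/-- Greedily adding tiles, one reaches a quasi-matching to which no further tile can be added
on one of the two sides. -/
lemma QuasiMatching.exists_saturated [Fintype X] {S : Finset Γ} {ε : ℝ} (hε : ε ≤ 1 / 4)
    {a b : Γ → Equiv.Perm X} (m₀ : QuasiMatching S ε a b) {K T F : Finset Γ}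
    (hF : F.Nonempty) (hFT : F ⊆ T) (hST : S ⊆ T) (hKT : K ⊆ T) {δ c : ℝ} (hδ : 0 ≤ δ)
    (hFS : ∀ s ∈ S, ((F.filter fun f => s * f ∉ F).card : ℝ) ≤ ε * F.card)
    (hFK : ∀ k ∈ K, ((F.filter fun f => k * f ∉ F).card : ℝ) ≤ δ * F.card)
    (hl : ∀ k ∈ K, ((escape (a k) m₀.left).card : ℝ) ≤ c)
    (hr : ∀ k ∈ K, ((escape (b k) m₀.right).card : ℝ) ≤ c) :
    ∃ m : QuasiMatching S ε a b, m₀.left ⊆ m.left ∧ m₀.right ⊆ m.right ∧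
      (∀ k ∈ K, ((escape (a k) m.left).card : ℝ) ≤ c + δ * m.vol) ∧
      (∀ k ∈ K, ((escape (b k) m.right).card : ℝ) ≤ c + δ * m.vol) ∧
      ((∀ x, IsGoodPoint a T x →
          ε * F.card < ((F.filter fun f => a f x ∈ m.left).card : ℝ)) ∨
        (∀ y, IsGoodPoint b T y →
          ε * F.card < ((F.filter fun f => b f y ∈ m.right).card : ℝ))) := by
  let P : ℕ → Prop := fun v => ∃ m : QuasiMatching S ε a b, m.vol = v ∧
    m₀.left ⊆ m.left ∧ m₀.right ⊆ m.right ∧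
      (∀ k ∈ K, ((escape (a k) m.left).card : ℝ) ≤ c + δ * m.vol) ∧
      (∀ k ∈ K, ((escape (b k) m.right).card : ℝ) ≤ c + δ * m.vol)
  have hPbound : ∀ v, P v → v ≤ 2 * Fintype.card X := by
    rintro v ⟨m, rfl, -⟩
    exact_mod_cast m.vol_le hε
  have hP₀ : P m₀.vol := by
    have h0 : 0 ≤ δ * m₀.vol := by positivity
    exact ⟨m₀, rfl, subset_rfl, subset_rfl, fun k hk => by linarith [hl k hk],
      fun k hk => by linarith [hr k hk]⟩
  classical
  have hspec := Nat.findGreatest_spec (P := P) (hPbound _ hP₀) hP₀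
  obtain ⟨m, hmv, h1, h2, h3, h4⟩ := hspec
  refine ⟨m, h1, h2, h3, h4, ?_⟩
  by_contra! hcon
  obtain ⟨⟨x, hx, hxA⟩, y, hy, hyB⟩ := hcon
  obtain ⟨m', hl', hr', hv'⟩ := m.exists_add_tile hx hy hFT hST hFS hxA hyB
  have hP' : P m'.vol := by
    refine ⟨m', rfl, ?_, ?_, fun k hk => ?_, fun k hk => ?_⟩
    · rw [hl']
      exact h1.trans Finset.subset_union_left
    · rw [hr']
      exact h2.trans Finset.subset_union_left
    · have : ((escape (a k) m'.left).card : ℝ) ≤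
          (escape (a k) m.left).card + (F.filter fun f => k * f ∉ F).card := by
        rw [hl']
        exact_mod_cast card_escape_union_tile hx hFT (hKT hk) m.left
      rw [hv']
      push_cast
      linarith [h3 k hk, hFK k hk]
    · have : ((escape (b k) m'.right).card : ℝ) ≤
          (escape (b k) m.right).card + (F.filter fun f => k * f ∉ F).card := by
        rw [hr']
        exact_mod_cast card_escape_union_tile hy hFT (hKT hk) m.right
      rw [hv']
      push_cast
      linarith [h4 k hk, hFK k hk]
  have := Nat.le_findGreatest (hPbound _ hP') hP'
  have := hF.card_pos
  omega

end Tiling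

/-- A set in a group which is almost invariant on the right under generators is almost invariant
under all finite subsets; inverting, we get left invariance. -/
lemma IsFolnerSeq.exists_invariant {Γ : Type*} [Group Γ] [DecidableEq Γ] {S : Finset Γ}
    {F : ℕ → Finset Γ} (hF : IsFolnerSeq S F) (hgen : Subgroup.closure (S : Set Γ) = ⊤)
    (K : Finset Γ) {δ : ℝ} (hδ : 0 < δ) :
    ∃ T : Finset Γ, T.Nonempty ∧
      ∀ k ∈ K, ((T.filter fun f => k * f ∉ T).card : ℝ) ≤ δ * T.card := by
  have key : ∀ γ : Γ, Tendsto
      (fun n => (((F n).filter fun f => f * γ ∉ F n).card : ℝ) / (F n).card) atTop (𝓝 0) := by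
    intro γ
    have hγ : γ ∈ Subgroup.closure (S : Set Γ) := by rw [hgen]; trivial
    induction hγ using Subgroup.closure_induction with
    | mem s hs =>
      refine (hF.2 s hs).congr fun n => ?_
      have : (F n).image (· * s) \ F n = ((F n).filter fun f => f * s ∉ F n).image (· * s) := by
        ext x
        simp only [Finset.mem_sdiff, Finset.mem_image, Finset.mem_filter]
        constructor
        · rintro ⟨⟨f, hf, rfl⟩, h⟩
          exact ⟨f, ⟨hf, h⟩, rfl⟩
        · rintro ⟨f, ⟨hf, h⟩, rfl⟩
          exact ⟨⟨f, hf, rfl⟩, h⟩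
      rw [this, Finset.card_image_of_injective _ (mul_left_injective s)]
    | one =>
      refine tendsto_const_nhds.congr fun n => ?_
      rw [Finset.filter_false_of_mem fun f hf => by simpa using hf]
      simp
    | mul γ η _ _ h1 h2 =>
      refine squeeze_zero (fun n => by positivity) (fun n => ?_) (by simpa using h1.add h2)
      rw [← add_div]
      gcongr
      have hsub : ((F n).filter fun f => f * (γ * η) ∉ F n) ⊆
          ((F n).filter fun f => f * γ ∉ F n) ∪
            ((F n).filter fun f => f * η ∉ F n).image (· * γ⁻¹) := by
        intro f hf
        simp only [Finset.mem_filter, Finset.mem_union, Finset.mem_image] at hf ⊢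
        by_cases h : f * γ ∈ F n
        · exact Or.inr ⟨f * γ, ⟨h, by simpa [mul_assoc] using hf.2⟩, by simp⟩
        · exact Or.inl ⟨hf.1, h⟩
      exact_mod_cast (Finset.card_le_card hsub).trans ((Finset.card_union_le _ _).trans
        (Nat.add_le_add_left Finset.card_image_le _))
    | inv γ _ h =>
      refine h.congr fun n => ?_
      have h1 := Finset.card_filter_add_card_filter_not (s := F n) (fun f => f * γ ∈ F n)
      have h2 := Finset.card_filter_add_card_filter_not (s := F n) (fun f => f * γ⁻¹ ∈ F n)
      have h3 : ((F n).filter fun f => f * γ⁻¹ ∈ F n) =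
          ((F n).filter fun f => f * γ ∈ F n).image (· * γ) := by
        ext x
        simp only [Finset.mem_filter, Finset.mem_image]
        constructor
        · rintro ⟨hx, h⟩
          exact ⟨x * γ⁻¹, ⟨h, by simpa using hx⟩, by simp⟩
        · rintro ⟨f, ⟨hf, h⟩, rfl⟩
          exact ⟨h, by simpa using hf⟩
      rw [h3, Finset.card_image_of_injective _ (mul_left_injective γ)] at h2
      have h4 : ((F n).filter fun f => f * γ ∉ F n).card =
        ((F n).filter fun f => f * γ⁻¹ ∉ F n).card := by omega
      rw [h4]
  have hev : ∀ᶠ n in atTop, ∀ k ∈ K,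
      (((F n).filter fun f => f * k⁻¹ ∉ F n).card : ℝ) / (F n).card < δ :=
    (Finset.eventually_all K).2 fun k _ => (key k⁻¹).eventually (gt_mem_nhds hδ)
  obtain ⟨n, hn⟩ := hev.exists
  refine ⟨(F n).image (·⁻¹), (hF.1 n).image _, fun k hk => ?_⟩
  have hpos : (0 : ℝ) < (F n).card := by exact_mod_cast (hF.1 n).card_pos
  have h1 := (div_lt_iff₀ hpos).1 (hn k hk)
  have h2 : ((F n).image (·⁻¹)).filter (fun f => k * f ∉ (F n).image (·⁻¹)) ⊆
      ((F n).filter fun f => f * k⁻¹ ∉ F n).image (·⁻¹) := by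
    intro f hf
    simp only [Finset.mem_filter, Finset.mem_image] at hf ⊢
    obtain ⟨⟨g, hg, rfl⟩, h⟩ := hf
    exact ⟨g, ⟨hg, fun h' => h ⟨_, h', by simp⟩⟩, rfl⟩
  have h3 : ((((F n).image (·⁻¹)).filter
      (fun f => k * f ∉ (F n).image (·⁻¹))).card : ℝ) ≤
        ((F n).filter fun f => f * k⁻¹ ∉ F n).card := by
    exact_mod_cast (Finset.card_le_card h2).trans Finset.card_image_le
  rw [Finset.card_image_of_injective _ inv_injective]
  linarith

/-- The proportion of points of `Fin n` satisfying `p n` tends to `0` along `ω`. -/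
def Negligible (ω : Filter ℕ) (p : ∀ n : ℕ, Fin n → Prop) : Prop :=
  Tendsto (fun n => ({x | p n x}.ncard : ℝ) / n) ω (𝓝 0)

namespace Negligible

variable {ω : Filter ℕ} {p q : ∀ n : ℕ, Fin n → Prop}

lemma mono (hq : Negligible ω q) (h : ∀ n x, p n x → q n x) : Negligible ω p := by
  refine squeeze_zero (fun n => by positivity) (fun n => ?_) hq
  gcongr
  · exact Set.toFinite _
  · exact h n _

lemma or (hp : Negligible ω p) (hq : Negligible ω q) :
    Negligible ω (fun n x => p n x ∨ q n x) := by
  refine squeeze_zero (fun n => by positivity) (fun n => ?_) (by simpa using Tendsto.add hp hq)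
  rw [← add_div]
  gcongr
  exact_mod_cast Set.ncard_union_le {x | p n x} {x | q n x}

lemma exists_finset {ι : Type*} (s : Finset ι) {p : ι → ∀ n : ℕ, Fin n → Prop}
    (hp : ∀ i ∈ s, Negligible ω (p i)) : Negligible ω (fun n x => ∃ i ∈ s, p i n x) := by
  classical
  induction s using Finset.induction_on with
  | empty => simpa [Negligible] using tendsto_const_nhds
  | insert i s _ ih =>
    refine ((hp i (Finset.mem_insert_self _ _)).or
      (ih fun j hj => hp j (Finset.mem_insert_of_mem hj))).mono fun n x => ?_
    rintro ⟨j, hj, h⟩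
    rcases Finset.mem_insert.1 hj with rfl | hj
    · exact Or.inl h
    · exact Or.inr ⟨j, hj, h⟩

lemma comp_perm (hp : Negligible ω p) (σ : ∀ n : ℕ, Equiv.Perm (Fin n)) :
    Negligible ω (fun n x => p n (σ n x)) := by
  refine Tendsto.congr (fun n => ?_) hp
  have : {x | p n (σ n x)} = (σ n).symm '' {x | p n x} := by
    ext x
    simp [Equiv.image_eq_preimage_symm]
  rw [this, Set.ncard_image_of_injective _ (σ n).symm.injective]

end Negligible

lemma rk_eq_ncard_div {n : ℕ} (hn : 0 < n) (g : Equiv.Perm (Fin n)) :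
    rk g = ({x | g x ≠ x}.ncard : ℝ) / n := by
  have h1 := Finset.card_filter_add_card_filter_not (s := Finset.univ) (fun x => g x = x)
  have h2 : {x | g x ≠ x}.ncard = (Finset.univ.filter fun x => ¬ g x = x).card := by
    rw [← Set.ncard_coe_finset]
    simp
  rw [Finset.card_univ, Fintype.card_fin] at h1
  have h3 : ((Finset.univ.filter fun x => g x = x).card : ℝ) +
      (Finset.univ.filter fun x => ¬ g x = x).card = n := by exact_mod_cast h1
  have hn' : (n : ℝ) ≠ 0 := by positivity
  rw [rk, h2, eq_div_iff hn', sub_mul, div_mul_cancel₀ _ hn']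
  linarith

lemma tendsto_rk_iff_negligible {ω : Filter ℕ} (hω : ω ≤ atTop)
    (g h : ∀ n : ℕ, Equiv.Perm (Fin n)) :
    Tendsto (fun n => rk ((g n)⁻¹ * h n)) ω (𝓝 0) ↔ Negligible ω (fun n x => h n x ≠ g n x) := by
  refine tendsto_congr' ?_
  filter_upwards [hω (eventually_gt_atTop 0)] with n hn
  rw [rk_eq_ncard_div hn]
  congr 3
  ext x
  simp only [Set.mem_ofPred_eq, Equiv.Perm.mul_apply, ne_eq, Equiv.Perm.inv_eq_iff_eq]

lemma negligible_fixed {ω : Filter ℕ} (g : ∀ n : ℕ, Equiv.Perm (Fin n))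
    (hg : Tendsto (fun n => rk (g n)) ω (𝓝 1)) : Negligible ω (fun n x => g n x = x) := by
  have h := (tendsto_const_nhds (x := (1 : ℝ))).sub hg
  rw [sub_self] at h
  refine h.congr fun n => ?_
  rw [rk, sub_sub_cancel, ← Set.ncard_coe_finset]
  simp

section Sofic

variable {Γ : Type*} [Group Γ] {ω : Ultrafilter ℕ} {φ ψ : Γ → ∀ n : ℕ, Equiv.Perm (Fin n)}

lemma IsSoficRep.negligible_mul (hω : (ω : Filter ℕ) ≤ atTop)
    (hφ : IsSoficRep ω (fun n => n) φ) (γ η : Γ) :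
    Negligible ω (fun n x => φ (γ * η) n x ≠ φ γ n (φ η n x)) :=
  (tendsto_rk_iff_negligible hω (fun n => φ γ n * φ η n) (φ (γ * η))).1 (hφ.1 γ η)

lemma IsSoficRep.negligible_one (hω : (ω : Filter ℕ) ≤ atTop)
    (hφ : IsSoficRep ω (fun n => n) φ) : Negligible ω (fun n x => φ 1 n x ≠ x) := by
  refine (hφ.negligible_mul hω 1 1).mono fun n x hx h => hx ?_
  rw [mul_one] at h
  exact ((φ 1 n).injective h).symm

lemma IsSoficRep.negligible_not_isGoodPoint (hω : (ω : Filter ℕ) ≤ atTop)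
    (hφ : IsSoficRep ω (fun n => n) φ) (T : Finset Γ) :
    Negligible ω (fun n x => ¬ IsGoodPoint (fun γ => φ γ n) T x) := by
  have h1 : Negligible ω (fun n x => ∃ q ∈ T ×ˢ T,
      φ (q.1 * q.2) n x ≠ φ q.1 n (φ q.2 n x)) :=
    Negligible.exists_finset _ fun q _ => hφ.negligible_mul hω q.1 q.2
  have h2 : Negligible ω (fun n x => ∃ q ∈ T ×ˢ T,
      φ (q.1 * (q.1⁻¹ * q.2)) n x ≠ φ q.1 n (φ (q.1⁻¹ * q.2) n x)) :=
    Negligible.exists_finset _ fun q _ => hφ.negligible_mul hω q.1 (q.1⁻¹ * q.2)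
  have h3 : Negligible ω (fun n x => ∃ q ∈ T ×ˢ T, q.1 ≠ q.2 ∧ φ (q.1⁻¹ * q.2) n x = x) := by
    refine Negligible.exists_finset _ fun q _ => ?_
    by_cases hq : q.1 = q.2
    · simp [Negligible, hq]
    · exact (negligible_fixed _ (hφ.2 (q.1⁻¹ * q.2) (by rwa [ne_eq, inv_mul_eq_one]))).mono
        fun n x h => h.2
  refine (h1.or (h2.or h3)).mono fun n x hx => ?_
  by_contra! hcon
  obtain ⟨c1, c2, c3⟩ := hcon
  refine hx ⟨fun k hk l hl => (c1 (k, l) (Finset.mk_mem_product hk hl)).symm, ?_⟩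
  intro k hk l hl hkl
  by_contra hne
  have hm := Finset.mk_mem_product hk hl
  refine c3 (k, l) hm hne ((φ k n).injective ?_)
  have := c2 (k, l) hm
  simp only [mul_inv_cancel_left] at this
  exact this.symm.trans hkl.symm

/-- For almost all `n`, the points of `Fin n` are good outside a set of small cardinality. -/
lemma IsSoficRep.eventually_good (hω : (ω : Filter ℕ) ≤ atTop)
    (hφ : IsSoficRep ω (fun n => n) φ) (T : Finset Γ) {d : ℝ} (hd : 0 < d) :
    ∀ᶠ n in (ω : Filter ℕ), ∃ E : Finset (Fin n), (E.card : ℝ) ≤ d * n ∧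
      ∀ x ∉ E, IsGoodPoint (fun γ => φ γ n) T x := by
  have h := (hφ.negligible_not_isGoodPoint hω T).eventually (gt_mem_nhds hd)
  filter_upwards [h, hω (eventually_gt_atTop 0)] with n hn hpos
  have hpos' : (0 : ℝ) < n := by exact_mod_cast hpos
  classical
  refine ⟨Finset.univ.filter fun x => ¬ IsGoodPoint (fun γ => φ γ n) T x, ?_, fun x hx => ?_⟩
  · rw [div_lt_iff₀ hpos'] at hn
    refine le_trans (le_of_eq ?_) hn.le
    rw [← Set.ncard_coe_finset]
    simp
  · simpa using hx

variable [DecidableEq Γ]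

/-- Quasi-matchings obtained from `j` successive scales of tiles. -/
lemma eventually_exists_quasiMatching (hω : (ω : Filter ℕ) ≤ atTop)
    (hφ : IsSoficRep ω (fun n => n) φ) (hψ : IsSoficRep ω (fun n => n) ψ) (S : Finset Γ)
    (hinv : ∀ (K : Finset Γ) (δ : ℝ), 0 < δ → ∃ T : Finset Γ, T.Nonempty ∧
      ∀ k ∈ K, ((T.filter fun f => k * f ∉ T).card : ℝ) ≤ δ * T.card)
    {ε : ℝ} (hε0 : 0 < ε) (hε : ε ≤ 1 / 4) (j : ℕ) :
    ∀ (K : Finset Γ) (δ : ℝ), 0 < δ → ∀ᶠ n : ℕ in (ω : Filter ℕ),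
      ∃ m : QuasiMatching S ε (fun γ => φ γ n) (fun γ => ψ γ n),
        (∀ k ∈ K, ((escape (φ k n) m.left).card : ℝ) ≤ δ * n) ∧
        (∀ k ∈ K, ((escape (ψ k n) m.right).card : ℝ) ≤ δ * n) ∧
        ((m.leftᶜ).card : ℝ) * (m.rightᶜ).card ≤ ((1 - ε) ^ j + δ) * (n * n) := by
  induction j with
  | zero =>
    intro K δ hδ
    refine Eventually.of_forall fun n => ⟨QuasiMatching.empty S ε _ _, ?_, ?_, ?_⟩
    · intro k _
      have : 0 ≤ δ * (n : ℝ) := by positivity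
      simpa [escape, QuasiMatching.empty] using this
    · intro k _
      have : 0 ≤ δ * (n : ℝ) := by positivity
      simpa [escape, QuasiMatching.empty] using this
    · simp only [QuasiMatching.empty, Finset.compl_empty, Finset.card_univ, Fintype.card_fin,
        pow_zero]
      have : 0 ≤ δ * ((n : ℝ) * n) := by positivity
      linarith
  | succ j ih =>
    intro K δ hδ
    obtain ⟨F, hF, hFinv⟩ := hinv (K ∪ S) (min (δ / 3) ε) (lt_min (by positivity) hε0)
    set T := K ∪ S ∪ F with hT
    have hFT : F ⊆ T := Finset.subset_union_right
    have hST : S ⊆ T := Finset.subset_union_right.trans Finset.subset_union_left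
    have hKT : K ⊆ T := Finset.subset_union_left.trans Finset.subset_union_left
    have hδ3 : 0 < δ / 3 := by positivity
    filter_upwards [ih (K ∪ F) (δ / 3) hδ3, hφ.eventually_good hω T hδ3,
      hψ.eventually_good hω T hδ3] with n hn hgφ hgψ
    obtain ⟨m₀, hl₀, hr₀, hprod₀⟩ := hn
    obtain ⟨m, hlm, hrm, hl, hr, hsat⟩ := m₀.exists_saturated hε hF hFT hST hKT hδ3.le
      (c := δ / 3 * n)
      (fun s hs => (hFinv s (Finset.mem_union_right _ hs)).trans
        (mul_le_mul_of_nonneg_right (min_le_right _ _) (Nat.cast_nonneg _)))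
      (fun k hk => (hFinv k (Finset.mem_union_left _ hk)).trans
        (mul_le_mul_of_nonneg_right (min_le_left _ _) (Nat.cast_nonneg _)))
      (fun k hk => hl₀ k (Finset.mem_union_left _ hk))
      (fun k hk => hr₀ k (Finset.mem_union_left _ hk))
    have hvol : δ / 3 * (m.vol : ℝ) ≤ δ / 3 * (2 * n) := by
      have := m.vol_le hε
      rw [Fintype.card_fin] at this
      gcongr
    refine ⟨m, fun k hk => by linarith [hl k hk], fun k hk => by linarith [hr k hk], ?_⟩
    have hle : ∀ A : Finset (Fin n), (A.card : ℝ) ≤ n := fun A => by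
      exact_mod_cast (Finset.card_le_univ A).trans_eq (Fintype.card_fin n)
    have hlc : ((m.leftᶜ).card : ℝ) ≤ (m₀.leftᶜ).card := by
      exact_mod_cast Finset.card_le_card (Finset.compl_subset_compl.2 hlm)
    have hrc : ((m.rightᶜ).card : ℝ) ≤ (m₀.rightᶜ).card := by
      exact_mod_cast Finset.card_le_card (Finset.compl_subset_compl.2 hrm)
    have hfinal : (1 - ε) * (((m₀.leftᶜ).card : ℝ) * (m₀.rightᶜ).card) +
        (δ / 3 * n + δ / 3 * n) * n ≤ ((1 - ε) ^ (j + 1) + δ) * (n * n) := by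
      have h1 : (1 - ε) * (((m₀.leftᶜ).card : ℝ) * (m₀.rightᶜ).card) ≤
          (1 - ε) * (((1 - ε) ^ j + δ / 3) * (n * n)) :=
        mul_le_mul_of_nonneg_left hprod₀ (by linarith)
      have h2 : 0 ≤ ε * (δ / 3 * ((n : ℝ) * n)) := by positivity
      have h3 : (1 - ε) ^ (j + 1) = (1 - ε) ^ j * (1 - ε) := pow_succ _ _
      rw [h3]
      linarith
    refine le_trans ?_ hfinal
    rcases hsat with hsat | hsat
    · have h := card_compl_le_of_saturated hF hlm hε0.le (by linarith) hgφ
        (fun f hf => hl₀ f (Finset.mem_union_right _ hf)) hsat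
      calc ((m.leftᶜ).card : ℝ) * (m.rightᶜ).card
          ≤ ((1 - ε) * (m₀.leftᶜ).card + (δ / 3 * n + δ / 3 * n)) * (m₀.rightᶜ).card :=
            mul_le_mul h hrc (by positivity) (le_trans (by positivity) h)
        _ = (1 - ε) * (((m₀.leftᶜ).card : ℝ) * (m₀.rightᶜ).card) +
            (δ / 3 * n + δ / 3 * n) * (m₀.rightᶜ).card := by ring
        _ ≤ _ := by
            gcongr
            exact_mod_cast hle _
    · have h := card_compl_le_of_saturated hF hrm hε0.le (by linarith) hgψ
        (fun f hf => hr₀ f (Finset.mem_union_right _ hf)) hsat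
      calc ((m.leftᶜ).card : ℝ) * (m.rightᶜ).card
          ≤ (m₀.leftᶜ).card * ((1 - ε) * (m₀.rightᶜ).card + (δ / 3 * n + δ / 3 * n)) :=
            mul_le_mul hlc h (by positivity) (by positivity)
        _ = (1 - ε) * (((m₀.leftᶜ).card : ℝ) * (m₀.rightᶜ).card) +
            (δ / 3 * n + δ / 3 * n) * (m₀.leftᶜ).card := by ring
        _ ≤ _ := by
            gcongr
            exact_mod_cast hle _

/-- For almost all `n` there is a permutation almost conjugating `ψ s` to `φ s`, `s ∈ S`. -/
lemma eventually_exists_almost_conj (hω : (ω : Filter ℕ) ≤ atTop)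
    (hφ : IsSoficRep ω (fun n => n) φ) (hψ : IsSoficRep ω (fun n => n) ψ) (S : Finset Γ)
    (hinv : ∀ (K : Finset Γ) (δ : ℝ), 0 < δ → ∃ T : Finset Γ, T.Nonempty ∧
      ∀ k ∈ K, ((T.filter fun f => k * f ∉ T).card : ℝ) ≤ δ * T.card)
    {η : ℝ} (hη : 0 < η) :
    ∀ᶠ n in (ω : Filter ℕ), ∃ g : Equiv.Perm (Fin n), ∀ s ∈ S,
      ({x | g (ψ s n x) ≠ φ s n (g x)}.ncard : ℝ) ≤ η * n := by
  set ε := min (η / 9) (1 / 4) with hεdef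
  have hε0 : 0 < ε := lt_min (by positivity) (by norm_num)
  have hε4 : ε ≤ 1 / 4 := min_le_right _ _
  have hεη : 9 * ε ≤ η := by linarith [min_le_left (η / 9) (1 / 4 : ℝ)]
  obtain ⟨j, hj⟩ := exists_pow_lt_of_lt_one (show 0 < ε ^ 2 / 2 by positivity)
    (show 1 - ε < 1 by linarith)
  filter_upwards [eventually_exists_quasiMatching hω hφ hψ S hinv hε0 hε4 j ∅ (ε ^ 2 / 2)
    (by positivity)] with n hn
  obtain ⟨m, -, -, hprod⟩ := hn
  obtain ⟨g, hg⟩ := m.exists_perm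
  refine ⟨g, fun s hs => ?_⟩
  have hcard : ({x | g (ψ s n x) ≠ φ s n (g x)}.ncard : ℝ) =
      (Finset.univ.filter fun x => g (ψ s n x) ≠ φ s n (g x)).card := by
    rw [← Set.ncard_coe_finset]
    simp
  rw [hcard]
  refine (hg s hs).trans ?_
  have hvol2 := m.vol_le hε4
  rw [Fintype.card_fin] at hvol2 ⊢
  have hsmall : ((m.leftᶜ).card : ℝ) ≤ ε * n ∨ ((m.rightᶜ).card : ℝ) ≤ ε * n := by
    by_contra! hcon
    have h1 : (ε * n) * (ε * n) < ((m.leftᶜ).card : ℝ) * (m.rightᶜ).card :=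
      mul_lt_mul'' hcon.1 hcon.2 (by positivity) (by positivity)
    have h2 : ((1 - ε) ^ j + ε ^ 2 / 2) * ((n : ℝ) * n) ≤ ε ^ 2 * (n * n) := by
      gcongr
      linarith
    linarith
  have hvol : (1 - ε) * n ≤ (m.vol : ℝ) := by
    rcases hsmall with h | h
    · have h1 : (m.left.card : ℝ) + (m.leftᶜ).card = n := by
        exact_mod_cast (Finset.card_add_card_compl _).trans (Fintype.card_fin n)
      have h2 : (m.left.card : ℝ) ≤ m.vol := by exact_mod_cast m.left_card
      linarith
    · have h1 : (m.right.card : ℝ) + (m.rightᶜ).card = n := by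
        exact_mod_cast (Finset.card_add_card_compl _).trans (Fintype.card_fin n)
      have h2 : (m.right.card : ℝ) ≤ m.vol := by exact_mod_cast m.right_card
      linarith
  have hpairs := m.pairs_card
  have hn0 : (0 : ℝ) ≤ n := Nat.cast_nonneg n
  have h1 : (1 - 2 * ε) * ((1 - ε) * n) ≤ (1 - 2 * ε) * (m.vol : ℝ) :=
    mul_le_mul_of_nonneg_left hvol (by linarith)
  have h2 : 3 * ε * (m.vol : ℝ) ≤ 3 * ε * (2 * n) := by gcongr
  have h3 : 0 ≤ ε * ε * (n : ℝ) := by positivity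
  have h4 : 9 * ε * (n : ℝ) ≤ η * n := by gcongr
  linarith

end Sofic

/-- For a finitely generated amenable group `Γ`, any two faithful embeddings
of `Γ` into the metric ultraproduct `Σ = (∏ₙ Sₙ)/H` are conjugate by an element of `Σ`. -/
theorem amenable_embeddings_conjugate {Γ : Type} [Group Γ] [DecidableEq Γ]
    (ω : Ultrafilter ℕ) (hω : (ω : Filter ℕ) ≤ Filter.cofinite)
    (S : Finset Γ) (hsym : ∀ s ∈ S, s⁻¹ ∈ S)
    (hgen : Subgroup.closure (S : Set Γ) = ⊤)
    (hamen : ∃ F : ℕ → Finset Γ, IsFolnerSeq S F)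
    (φ ψ : Γ → ∀ n : ℕ, Equiv.Perm (Fin n))
    (hφ : IsSoficRep ω (fun n => n) φ) (hψ : IsSoficRep ω (fun n => n) ψ) :
    ConjugateReps ω (fun n => n) φ ψ := by
  obtain ⟨F, hF⟩ := hamen
  rw [Nat.cofinite_eq_atTop] at hω
  have hmin : ∀ n : ℕ, ∃ g : Equiv.Perm (Fin n), ∀ h : Equiv.Perm (Fin n),
      ∑ s ∈ S, {x | g (ψ s n x) ≠ φ s n (g x)}.ncard ≤
        ∑ s ∈ S, {x | h (ψ s n x) ≠ φ s n (h x)}.ncard := fun n =>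
    Finite.exists_min fun g : Equiv.Perm (Fin n) =>
      ∑ s ∈ S, {x | g (ψ s n x) ≠ φ s n (g x)}.ncard
  choose g hg using hmin
  have hgS : ∀ s ∈ S, Negligible ω (fun n x => g n (ψ s n x) ≠ φ s n (g n x)) := by
    intro s hs
    refine tendsto_order.2 ⟨fun r hr => Eventually.of_forall fun n => hr.trans_le (by positivity),
      fun r hr => ?_⟩
    have hη : 0 < r / (S.card + 1) := by positivity
    filter_upwards [eventually_exists_almost_conj hω hφ hψ S
      (fun K δ hδ => hF.exists_invariant hgen K hδ) hη, hω (eventually_gt_atTop 0)]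
      with n hn hpos
    obtain ⟨h, hh⟩ := hn
    have hpos' : (0 : ℝ) < n := by exact_mod_cast hpos
    rw [div_lt_iff₀ hpos']
    have h1 : {x | g n (ψ s n x) ≠ φ s n (g n x)}.ncard ≤
        ∑ s ∈ S, {x | h (ψ s n x) ≠ φ s n (h x)}.ncard :=
      (Finset.single_le_sum (f := fun s => {x | g n (ψ s n x) ≠ φ s n (g n x)}.ncard)
        (fun _ _ => Nat.zero_le _) hs).trans (hg n h)
    have h2 : ({x | g n (ψ s n x) ≠ φ s n (g n x)}.ncard : ℝ) ≤
        ∑ s ∈ S, ({x | h (ψ s n x) ≠ φ s n (h x)}.ncard : ℝ) := by exact_mod_cast h1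
    calc ({x | g n (ψ s n x) ≠ φ s n (g n x)}.ncard : ℝ)
        ≤ ∑ s ∈ S, ({x | h (ψ s n x) ≠ φ s n (h x)}.ncard : ℝ) := h2
      _ ≤ ∑ s ∈ S, r / (S.card + 1) * n := Finset.sum_le_sum hh
      _ = S.card * (r / (S.card + 1) * n) := by rw [Finset.sum_const, nsmul_eq_mul]
      _ < (S.card + 1) * (r / (S.card + 1) * n) := by
          have : 0 < r / (S.card + 1) * n := by positivity
          linarith
      _ = r * n := by field_simp
  have hgall : ∀ γ : Γ, Negligible ω (fun n x => g n (ψ γ n x) ≠ φ γ n (g n x)) := by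
    intro γ
    have hγ : γ ∈ Subgroup.closure (S : Set Γ) := by rw [hgen]; trivial
    induction hγ using Subgroup.closure_induction with
    | mem s hs => exact hgS s hs
    | one =>
      refine ((hψ.negligible_one hω).or ((hφ.negligible_one hω).comp_perm g)).mono
        fun n x hx => ?_
      by_contra! hcon
      rw [hcon.1, hcon.2] at hx
      exact hx rfl
    | mul γ η _ _ h1 h2 =>
      refine ((h2.or (h1.comp_perm (ψ η))).or ((hψ.negligible_mul hω γ η).or
        ((hφ.negligible_mul hω γ η).comp_perm g))).mono fun n x hx => ?_
      by_contra! hcon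
      obtain ⟨⟨c1, c2⟩, c3, c4⟩ := hcon
      rw [c3, c4, c2, c1] at hx
      exact hx rfl
    | inv γ _ h =>
      have hψ' := (hψ.negligible_mul hω γ γ⁻¹).or (hψ.negligible_one hω)
      have hφ' := ((hφ.negligible_mul hω γ⁻¹ γ).or (hφ.negligible_one hω)).comp_perm
        (fun n => g n * ψ γ⁻¹ n)
      refine ((h.comp_perm (ψ γ⁻¹)).or (hψ'.or hφ')).mono fun n x hx => ?_
      by_contra! hcon
      obtain ⟨c1, ⟨c2, c3⟩, c4, c5⟩ := hcon
      rw [mul_inv_cancel, c3] at c2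
      rw [inv_mul_cancel, c5, Equiv.Perm.mul_apply, ← c1, ← c2] at c4
      exact hx c4
  refine ⟨g, fun γ => (tendsto_rk_iff_negligible hω
    (fun n => g n * ψ γ n * (g n)⁻¹) (φ γ)).2 ?_⟩
  refine ((hgall γ).comp_perm fun n => (g n)⁻¹).mono fun n x hx h => hx ?_
  simpa using h.symm
end
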